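/- arXiv:1407.4688 — 2 statements merged into one kernel-verified Lean document; each statement's English description precedes it below -/
import Mathlib

section
/- As t → 0⁺, one has f(e^{−t}) ~ 1/(t·log(1/t)), i.e. t·log(1/t)·f(e^{−t}) → 1; equivalently, as z → 1⁻, f(z) ~ −1/(log(1/z)·log log(1/z)). -/
open Filter Topology

/-- `f z = ∑_{p odd prime} z^p`. -/
noncomputable def f (z : ℝ) : ℝ := ∑' p : ℕ, if Nat.Prime p ∧ Odd p then z ^ p else 0

open MeasureTheory FourierTransform

lemma integrable_exp_neg_mul_smul {D : ℝ → ℂ} {C δ : ℝ} (hD : Continuous D)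
    (h1 : ∀ u, ‖D u‖ ≤ C) (h2 : ∀ u, ‖D u‖ ≤ C * Real.exp u) (hδ : 0 < δ) (hδ1 : δ < 1) :
    Integrable (fun u => Real.exp (-δ * u) • D u) := by
  have hc : Continuous (fun u => Real.exp (-δ * u) • D u) := by fun_prop
  rw [← integrableOn_univ, ← Set.Iic_union_Ioi (a := (0 : ℝ))]
  refine IntegrableOn.union ?_ ?_
  · have : IntegrableOn (fun u : ℝ => C * Real.exp ((1 - δ) * u)) (Set.Iic 0) :=
      (integrableOn_exp_mul_Iic (by linarith) 0).const_mul C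
    refine this.mono' hc.aestronglyMeasurable (.of_forall fun u => ?_)
    rw [norm_smul, Real.norm_eq_abs, Real.abs_exp]
    calc _ ≤ Real.exp (-δ * u) * (C * Real.exp u) := by gcongr; exact h2 u
      _ = _ := by rw [mul_left_comm, ← Real.exp_add]; ring_nf
  · have : IntegrableOn (fun u : ℝ => C * Real.exp (-δ * u)) (Set.Ioi 0) :=
      (integrableOn_exp_mul_Ioi (by linarith) 0).const_mul C
    refine this.mono' hc.aestronglyMeasurable (.of_forall fun u => ?_)
    rw [norm_smul, Real.norm_eq_abs, Real.abs_exp, mul_comm]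
    gcongr
    exact h1 u

lemma norm_exp_neg_mul_smul_le {D : ℝ → ℂ} {C δ : ℝ}
    (h1 : ∀ u, ‖D u‖ ≤ C) (h2 : ∀ u, ‖D u‖ ≤ C * Real.exp u) (hδ : 0 < δ) (hδ1 : δ < 1) (u : ℝ) :
    ‖Real.exp (-δ * u) • D u‖ ≤ C := by
  have hC : 0 ≤ C := (norm_nonneg _).trans (h1 0)
  rw [norm_smul, Real.norm_eq_abs, Real.abs_exp]
  rcases le_total 0 u with hu | hu
  · calc _ ≤ 1 * C := by
          gcongr
          · exact Real.exp_le_one_iff.2 (by nlinarith)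
          · exact h1 u
      _ = C := one_mul C
  · calc _ ≤ Real.exp (-δ * u) * (C * Real.exp u) := by gcongr; exact h2 u
      _ = C * Real.exp ((1 - δ) * u) := by rw [mul_left_comm, ← Real.exp_add]; ring_nf
      _ ≤ C * 1 := by
          gcongr
          exact Real.exp_le_one_iff.2 (by nlinarith)
      _ = C := mul_one C

/-- Multiplication formula for the Fourier transform of a translate. -/
lemma integral_comp_add_mul_fourier {D φ : ℝ → ℂ} (hD : Integrable D) (hφ : Integrable φ) (v : ℝ) :
    ∫ u, D (u + v) * 𝓕 φ u = ∫ y, Real.fourierChar (v * y) • (𝓕 D y * φ y) := by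
  have h := VectorFourier.integral_fourierIntegral_smul_eq_flip (μ := volume) (ν := volume)
    (f := D ∘ fun u => u + v) (g := φ) (L := innerₗ ℝ) Real.continuous_fourierChar
    (by exact continuous_inner) (hD.comp_add_right v) hφ
  rw [VectorFourier.fourierIntegral_comp_add_right, flip_innerₗ] at h
  refine Eq.trans ?_ (h.symm.trans ?_)
  · rfl
  · refine integral_congr_ae (.of_forall fun y => ?_)
    simp only [innerₗ_apply_apply, smul_eq_mul, smul_mul_assoc]
    rw [show inner ℝ v y = v * y by simp [mul_comm]]
    rfl

/-- If the Fourier transforms of the damped functions `exp (-δ u) D u` extend continuously to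
`δ = 0`, then `D` averages to zero at infinity against band-limited kernels. -/
lemma tendsto_integral_comp_add_mul_fourier {D : ℝ → ℂ} {C : ℝ} (hD : Continuous D)
    (h1 : ∀ u, ‖D u‖ ≤ C) (h2 : ∀ u, ‖D u‖ ≤ C * Real.exp u)
    {G : ℂ → ℂ} (hG : ContinuousOn G {s | 1 ≤ s.re})
    (hDG : ∀ δ : ℝ, 0 < δ → δ < 1 → ∀ y : ℝ,
      𝓕 (fun u => Real.exp (-δ * u) • D u) y = G ⟨1 + δ, 2 * Real.pi * y⟩)
    {φ : ℝ → ℂ} (hφ : Continuous φ) (hφc : HasCompactSupport φ) (hφi : Integrable (𝓕 φ)) :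
    Tendsto (fun v => ∫ u, D (u + v) * 𝓕 φ u) atTop (𝓝 0) := by
  have hφ1 : Integrable φ := hφ.integrable_of_hasCompactSupport hφc
  have key : ∀ v : ℝ, ∫ u, D (u + v) * 𝓕 φ u =
      ∫ y, Real.fourierChar (v * y) • (G ⟨1, 2 * Real.pi * y⟩ * φ y) := by
    intro v
    have hmem : ∀ᶠ δ : ℝ in 𝓝[>] 0, 0 < δ ∧ δ < 1 :=
      Ioo_mem_nhdsGT one_pos
    have hL : Tendsto (fun δ : ℝ => ∫ u, (Real.exp (-δ * (u + v)) • D (u + v)) * 𝓕 φ u) (𝓝[>] 0)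
        (𝓝 (∫ u, D (u + v) * 𝓕 φ u)) := by
      refine tendsto_integral_filter_of_dominated_convergence (fun u => C * ‖𝓕 φ u‖) ?_ ?_
        (hφi.norm.const_mul C) ?_
      · exact .of_forall fun δ => (Continuous.aestronglyMeasurable (by fun_prop)).mul
          hφi.aestronglyMeasurable
      · filter_upwards [hmem] with δ hδ
        refine .of_forall fun u => ?_
        rw [norm_mul]
        gcongr
        exact norm_exp_neg_mul_smul_le h1 h2 hδ.1 hδ.2 (u + v)
      · refine .of_forall fun u => ?_
        have : Continuous (fun δ : ℝ => (Real.exp (-δ * (u + v)) • D (u + v)) * 𝓕 φ u) := by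
          fun_prop
        simpa using (this.tendsto 0).mono_left nhdsWithin_le_nhds
    have hR : Tendsto (fun δ : ℝ =>
        ∫ y, Real.fourierChar (v * y) • (G ⟨1 + max δ 0, 2 * Real.pi * y⟩ * φ y)) (𝓝[>] 0)
        (𝓝 (∫ y, Real.fourierChar (v * y) • (G ⟨1, 2 * Real.pi * y⟩ * φ y))) := by
      have hGc : Continuous (fun p : ℝ × ℝ => G ⟨1 + max p.1 0, 2 * Real.pi * p.2⟩) := by
        refine hG.comp_continuous ?_ fun p => ?_
        · exact Complex.equivRealProdCLM.symm.continuous.comp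
            (f := fun p : ℝ × ℝ => (1 + max p.1 0, 2 * Real.pi * p.2)) (by fun_prop)
        · simp
      have hc : Continuous (fun δ : ℝ => ∫ y in tsupport φ,
          Real.fourierChar (v * y) • (G ⟨1 + max δ 0, 2 * Real.pi * y⟩ * φ y)) := by
        refine continuous_parametric_integral_of_continuous ?_ hφc
        exact (Real.continuous_fourierChar.comp (by fun_prop)).smul
          (hGc.mul (hφ.comp continuous_snd))
      have hs : ∀ δ : ℝ, ∫ y in tsupport φ,
          Real.fourierChar (v * y) • (G ⟨1 + max δ 0, 2 * Real.pi * y⟩ * φ y) =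
          ∫ y, Real.fourierChar (v * y) • (G ⟨1 + max δ 0, 2 * Real.pi * y⟩ * φ y) := by
        intro δ
        refine setIntegral_eq_integral_of_forall_compl_eq_zero fun y hy => ?_
        simp [image_eq_zero_of_notMem_tsupport hy]
      simp_rw [hs] at hc
      simpa using (hc.tendsto 0).mono_left nhdsWithin_le_nhds
    refine tendsto_nhds_unique (hL.congr' ?_) hR
    filter_upwards [hmem] with δ hδ
    rw [integral_comp_add_mul_fourier
      (integrable_exp_neg_mul_smul hD h1 h2 hδ.1 hδ.2) hφ1 v]
    simp_rw [hDG δ hδ.1 hδ.2, max_eq_left hδ.1.le]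
  simp_rw [key]
  have := (Real.tendsto_integral_exp_smul_cocompact
    (fun y => G ⟨1, 2 * Real.pi * y⟩ * φ y)).comp
    ((tendsto_neg_atTop_atBot (G := ℝ)).mono_right atBot_le_cocompact)
  refine this.congr fun v => ?_
  simp [mul_comm]

/-- There is an integrable band-limited kernel with total mass one and finite first moment. -/
lemma exists_bandlimited_kernel : ∃ φ : ℝ → ℂ, Continuous φ ∧ HasCompactSupport φ ∧
    Integrable (𝓕 φ) ∧ Integrable (fun u : ℝ => |u| * ‖𝓕 φ u‖) ∧ ∫ u, 𝓕 φ u = 1 := by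
  let b : ContDiffBump (0 : ℝ) := ⟨1, 2, one_pos, one_lt_two⟩
  have hb : HasCompactSupport (fun y => (b y : ℂ)) :=
    b.hasCompactSupport.comp_left (g := Complex.ofReal) Complex.ofReal_zero
  have hb' : ContDiff ℝ (⊤ : ℕ∞) (fun y => (b y : ℂ)) := Complex.ofRealCLM.contDiff.comp b.contDiff
  obtain ⟨φ, hφ⟩ : ∃ φ : SchwartzMap ℝ ℂ, ⇑φ = fun y => (b y : ℂ) :=
    ⟨hb.toSchwartzMap hb', rfl⟩
  have hφ0 : φ 0 = 1 := by
    simp [hφ, b.one_of_mem_closedBall (x := 0) (by simp [b.rIn_pos.le])]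
  have hi : Integrable (𝓕 (φ : ℝ → ℂ)) := by
    rw [← SchwartzMap.fourier_coe]; exact (𝓕 φ).integrable
  refine ⟨φ, φ.continuous, hφ ▸ hb, hi, ?_, ?_⟩
  · have h := (𝓕 φ).integrable_pow_mul volume 1
    simp only [pow_one, Real.norm_eq_abs, SchwartzMap.fourier_coe] at h
    exact h
  · have h := congrFun (φ.continuous.fourierInv_fourier_eq φ.integrable hi) 0
    rw [Real.fourierInv_eq, hφ0] at h
    simpa using h

/-- Scaling for the Fourier transform on the line. -/
lemma fourier_comp_div (φ : ℝ → ℂ) {r : ℝ} (hr : 0 < r) (u : ℝ) :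
    𝓕 (fun y => φ (y / r)) u = r * 𝓕 φ (r * u) := by
  rw [Real.fourier_real_eq, Real.fourier_real_eq]
  have := Measure.integral_comp_div (fun y => Real.fourierChar (-(y * (r * u))) • φ y) r
  rw [abs_of_pos hr, Complex.real_smul] at this
  rw [← this]
  congr! 5 with y
  field_simp

/-- A Lipschitz bounded function whose damped Fourier transforms extend continuously to the
boundary tends to zero at infinity. -/
theorem tendsto_zero_of_fourier_boundary {D : ℝ → ℂ} {C K : ℝ} (hD : Continuous D)
    (h1 : ∀ u, ‖D u‖ ≤ C) (h2 : ∀ u, ‖D u‖ ≤ C * Real.exp u)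
    (hK : ∀ u v, ‖D u - D v‖ ≤ K * |u - v|)
    {G : ℂ → ℂ} (hG : ContinuousOn G {s | 1 ≤ s.re})
    (hDG : ∀ δ : ℝ, 0 < δ → δ < 1 → ∀ y : ℝ,
      𝓕 (fun u => Real.exp (-δ * u) • D u) y = G ⟨1 + δ, 2 * Real.pi * y⟩) :
    Tendsto D atTop (𝓝 0) := by
  obtain ⟨φ, hφ, hφc, hφi, hφm, hφ1⟩ := exists_bandlimited_kernel
  have hC : 0 ≤ C := (norm_nonneg _).trans (h1 0)
  set M := ∫ u : ℝ, |u| * ‖𝓕 φ u‖ with hM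
  have main : ∀ r : ℝ, 0 < r → ∀ᶠ v in atTop, ‖D v‖ ≤ (1 + K * M) / r := by
    intro r hr
    have hs : Continuous (fun y => φ (y / r)) := by fun_prop
    have hsc : HasCompactSupport (fun y => φ (y / r)) := by
      simpa [div_eq_mul_inv, Function.comp_def] using
        hφc.comp_homeomorph (Homeomorph.mulRight₀ r⁻¹ (inv_ne_zero hr.ne'))
    have hsi : Integrable (𝓕 (fun y => φ (y / r))) := by
      rw [funext (fourier_comp_div φ hr)]
      exact (hφi.comp_mul_left' hr.ne').const_mul _
    have hint : ∀ v : ℝ, ∫ u, D (u + v) * 𝓕 (fun y => φ (y / r)) u =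
        ∫ u, D (u / r + v) * 𝓕 φ u := by
      intro v
      have := Measure.integral_comp_mul_left (fun u => D (u / r + v) * 𝓕 φ u) r
      rw [abs_of_pos (inv_pos.2 hr), Complex.real_smul] at this
      simp_rw [fourier_comp_div φ hr]
      rw [show ∀ a b : ℂ, a = (r⁻¹ : ℝ) * b ↔ b = r * a from fun a b => by
        have : (r : ℂ) ≠ 0 := by exact_mod_cast hr.ne'
        push_cast
        constructor <;> rintro rfl <;> field_simp] at this
      rw [this, ← integral_const_mul]
      congr! 2 with u
      rw [mul_div_cancel_left₀ _ hr.ne']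
      ring
    have ht := tendsto_integral_comp_add_mul_fourier hD h1 h2 hG hDG hs hsc hsi
    filter_upwards [(tendsto_zero_iff_norm_tendsto_zero.1 ht).eventually_le_const
      (one_div_pos.2 hr)] with v hv
    rw [hint] at hv
    have hi1 : Integrable (fun u => D (u / r + v) * 𝓕 φ u) :=
      hφi.bdd_mul (Continuous.aestronglyMeasurable (by fun_prop)) (.of_forall fun u => h1 _)
    have hdiff : D v - ∫ u, D (u / r + v) * 𝓕 φ u = ∫ u, (D v - D (u / r + v)) * 𝓕 φ u := by
      simp_rw [sub_mul]
      rw [integral_sub (hφi.const_mul _) hi1, integral_const_mul, hφ1, mul_one]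
    have hbd : ‖∫ u, (D v - D (u / r + v)) * 𝓕 φ u‖ ≤ K / r * M := by
      rw [hM, ← integral_const_mul]
      refine norm_integral_le_of_norm_le (hφm.const_mul _) (.of_forall fun u => ?_)
      rw [norm_mul]
      calc _ ≤ K * |v - (u / r + v)| * ‖𝓕 φ u‖ := by gcongr; exact hK _ _
        _ = _ := by
          rw [show v - (u / r + v) = -(u / r) by ring, abs_neg, abs_div, abs_of_pos hr]
          ring
    calc ‖D v‖ = ‖(∫ u, D (u / r + v) * 𝓕 φ u) + ∫ u, (D v - D (u / r + v)) * 𝓕 φ u‖ := by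
          rw [← hdiff]; simp
      _ ≤ 1 / r + K / r * M := (norm_add_le _ _).trans (add_le_add hv hbd)
      _ = _ := by ring
  have hl : Tendsto (fun r : ℝ => (1 + K * M) / r) atTop (𝓝 0) := tendsto_id.const_div_atTop _
  rw [Metric.tendsto_nhds]
  intro ε hε
  obtain ⟨r, hr, hrε⟩ := ((eventually_gt_atTop 0).and (hl.eventually_lt_const hε)).exists
  filter_upwards [main r hr] with v hv
  simpa using hv.trans_lt hrε

lemma hasSum_nat_mul_exp {t : ℝ} (ht : 0 < t) (α β : ℝ) :
    HasSum (fun n : ℕ => (α * n + β) * Real.exp (-(n : ℝ) * t))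
      ((α / (Real.exp t - 1) + β) / (1 - Real.exp (-t))) := by
  have hz : ‖Real.exp (-t)‖ < 1 := by
    rw [Real.norm_eq_abs, Real.abs_exp]; exact Real.exp_lt_one_iff.2 (by linarith)
  have h1 := (hasSum_coe_mul_geometric_of_norm_lt_one hz).mul_left α
  have h2 := (hasSum_geometric_of_norm_lt_one hz).mul_left β
  have hpow : ∀ n : ℕ, Real.exp (-(n : ℝ) * t) = Real.exp (-t) ^ n := fun n => by
    rw [← Real.exp_nat_mul]; ring_nf
  have hne : Real.exp t - 1 ≠ 0 := by
    have := Real.add_one_lt_exp ht.ne'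
    linarith
  have h4 : (α / (Real.exp t - 1) + β) / (1 - Real.exp (-t)) =
      α * (Real.exp (-t) / (1 - Real.exp (-t)) ^ 2) + β * (1 - Real.exp (-t))⁻¹ := by
    have h3 : 1 - Real.exp (-t) = (Real.exp t - 1) / Real.exp t := by
      rw [Real.exp_neg]; field_simp
    rw [h3, Real.exp_neg]
    field_simp
  rw [h4]
  refine (h1.add h2).congr_fun fun n => ?_
  rw [hpow]; ring

/-- Abelian bound: linear growth of the partial sums bounds the exponential sum. -/
lemma summable_and_tsum_exp_le {a : ℕ → ℝ} (ha : ∀ n, 0 ≤ a n) {α β : ℝ}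
    (hS : ∀ n : ℕ, ∑ i ∈ Finset.range (n + 1), a i ≤ α * n + β) {t : ℝ} (ht : 0 < t) :
    Summable (fun n : ℕ => a n * Real.exp (-(n : ℝ) * t)) ∧
      ∑' n : ℕ, a n * Real.exp (-(n : ℝ) * t) ≤ α / (Real.exp t - 1) + β := by
  have hz : 0 < 1 - Real.exp (-t) := sub_pos.2 (Real.exp_lt_one_iff.2 (by linarith))
  have hB := hasSum_nat_mul_exp ht α β
  set S : ℕ → ℝ := fun n => ∑ i ∈ Finset.range (n + 1), a i with hSdef
  have haS : ∀ n, a n ≤ S n := fun n =>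
    Finset.single_le_sum (fun i _ => ha i) (Finset.self_mem_range_succ n)
  have hSs : Summable (fun n : ℕ => S n * Real.exp (-(n : ℝ) * t)) :=
    .of_nonneg_of_le (fun n => mul_nonneg ((ha n).trans (haS n)) (Real.exp_pos _).le)
      (fun n => mul_le_mul_of_nonneg_right (hS n) (Real.exp_pos _).le) hB.summable
  have has : Summable (fun n : ℕ => a n * Real.exp (-(n : ℝ) * t)) :=
    .of_nonneg_of_le (fun n => mul_nonneg (ha n) (Real.exp_pos _).le)
      (fun n => mul_le_mul_of_nonneg_right (haS n) (Real.exp_pos _).le) hSs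
  refine ⟨has, ?_⟩
  have hrec : ∑' n : ℕ, S n * Real.exp (-(n : ℝ) * t) =
      Real.exp (-t) * ∑' n : ℕ, S n * Real.exp (-(n : ℝ) * t) +
        ∑' n : ℕ, a n * Real.exp (-(n : ℝ) * t) := by
    rw [has.tsum_eq_zero_add, ← tsum_mul_left]
    nth_rw 1 [hSs.tsum_eq_zero_add]
    rw [add_left_comm, ← (hSs.mul_left _).tsum_add ((summable_nat_add_iff 1).2 has)]
    congr 1
    · simp [hSdef]
    · refine tsum_congr fun n => ?_
      rw [show S (n + 1) = S n + a (n + 1) from Finset.sum_range_succ _ _]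
      rw [show Real.exp (-((n + 1 : ℕ) : ℝ) * t) = Real.exp (-t) * Real.exp (-(n : ℝ) * t) by
        rw [← Real.exp_add]; push_cast; ring_nf]
      ring
  have hle := hSs.tsum_le_tsum (fun n => mul_le_mul_of_nonneg_right (hS n) (Real.exp_pos _).le)
    hB.summable
  rw [hB.tsum_eq, le_div_iff₀ hz] at hle
  linarith

lemma div_exp_sub_one_le {t : ℝ} (ht : 0 < t) : t / (Real.exp t - 1) ≤ 1 := by
  have := Real.add_one_lt_exp ht.ne'
  rw [div_le_one (by linarith)]
  linarith

lemma div_exp_sub_one_le_two_div {t : ℝ} (ht : 0 < t) : t / (Real.exp t - 1) ≤ 2 / t := by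
  have h1 := Real.add_one_lt_exp ht.ne'
  have := Real.quadratic_le_exp_of_nonneg ht.le
  rw [div_le_div_iff₀ (by linarith) ht]
  nlinarith

lemma abs_tsum_exp_le {c : ℕ → ℝ} {α : ℝ}
    (hS : ∀ n : ℕ, ∑ i ∈ Finset.range (n + 1), |c i| ≤ α * n) {t : ℝ} (ht : 0 < t) :
    |∑' n : ℕ, c n * Real.exp (-(n : ℝ) * t)| ≤ α / (Real.exp t - 1) := by
  obtain ⟨h1, h2⟩ := summable_and_tsum_exp_le (fun n => abs_nonneg (c n)) (β := 0)
    (by simpa using hS) ht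
  refine (tsum_of_norm_bounded (E := ℝ) (g := fun n : ℕ => |c n| * Real.exp (-(n : ℝ) * t)) h1.hasSum
    fun n => ?_).trans (by simpa using h2)
  simp

lemma summable_exp_of_abs {c : ℕ → ℝ} {α : ℝ}
    (hS : ∀ n : ℕ, ∑ i ∈ Finset.range (n + 1), |c i| ≤ α * n) {t : ℝ} (ht : 0 < t) :
    Summable fun n : ℕ => c n * Real.exp (-(n : ℝ) * t) := by
  obtain ⟨h1, -⟩ := summable_and_tsum_exp_le (fun n => abs_nonneg (c n)) (β := 0)
    (by simpa using hS) ht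
  refine .of_norm (h1.congr fun n => ?_)
  rw [norm_mul, Real.norm_eq_abs, Real.norm_eq_abs, Real.abs_exp]

lemma abs_exp_neg_mul_exp_sub_le (n : ℕ) {u v : ℝ} (huv : u ≤ v) (hv : v ≤ u + 1) :
    |Real.exp (-u) * Real.exp (-(n : ℝ) * Real.exp (-u)) -
      Real.exp (-v) * Real.exp (-(n : ℝ) * Real.exp (-v))| ≤
    2 * Real.exp (-u) * Real.exp (-(n : ℝ) * (Real.exp (-u) / 6)) * |u - v| := by
  set h : ℝ → ℝ := fun w => Real.exp (-w) * Real.exp (-(n : ℝ) * Real.exp (-w)) with hh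
  have hd : ∀ w, HasDerivAt h ((n * Real.exp (-w) - 1) * h w) w := by
    intro w
    have h1 : HasDerivAt (fun w => Real.exp (-w)) (-Real.exp (-w)) w := by
      simpa using (hasDerivAt_neg w).exp
    refine (h1.mul (h1.const_mul (-(n : ℝ))).exp).congr_deriv ?_
    simp only [hh]
    ring
  have hb : ∀ w ∈ Set.Icc u v, ‖(n * Real.exp (-w) - 1) * h w‖ ≤
      2 * Real.exp (-u) * Real.exp (-(n : ℝ) * (Real.exp (-u) / 6)) := by
    intro w hw
    set y := n * Real.exp (-w) with hy
    have hy0 : 0 ≤ y := by positivity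
    have hw1 : Real.exp (-w) ≤ Real.exp (-u) := Real.exp_le_exp.2 (by linarith [hw.1])
    have hw2 : Real.exp (-u) / 3 ≤ Real.exp (-w) := by
      have h3 : Real.exp 1 < 3 := Real.exp_one_lt_three
      have : Real.exp (-u) ≤ Real.exp (-w) * Real.exp 1 := by
        rw [← Real.exp_add]; exact Real.exp_le_exp.2 (by linarith [hw.2])
      nlinarith [Real.exp_pos (-w)]
    have hy1 : |y - 1| ≤ 2 * Real.exp (y / 2) := by
      have := Real.add_one_le_exp (y / 2)
      rw [abs_le]; constructor <;> linarith
    calc ‖(y - 1) * h w‖ = |y - 1| * (Real.exp (-w) * Real.exp (-y)) := by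
          rw [Real.norm_eq_abs, abs_mul, hh, abs_of_pos (a := _ * _) (by positivity), hy, neg_mul]
      _ ≤ 2 * Real.exp (y / 2) * (Real.exp (-u) * Real.exp (-y)) := by gcongr
      _ = 2 * Real.exp (-u) * Real.exp (-(y / 2)) := by
          rw [show -(y / 2) = y / 2 + -y by ring, Real.exp_add]; ring
      _ ≤ _ := by
          gcongr
          have : (n : ℝ) * (Real.exp (-u) / 3) ≤ y := by rw [hy]; gcongr
          linarith
  have := (convex_Icc u v).norm_image_sub_le_of_norm_hasDerivWithin_le
    (fun w _ => (hd w).hasDerivWithinAt) hb (Set.right_mem_Icc.2 huv) (Set.left_mem_Icc.2 huv)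
  simpa [hh] using this

lemma abs_smoothed_sub_le {c : ℕ → ℝ} {α : ℝ}
    (hS : ∀ n : ℕ, ∑ i ∈ Finset.range (n + 1), |c i| ≤ α * n) (u v : ℝ) :
    |Real.exp (-u) * ∑' n : ℕ, c n * Real.exp (-(n : ℝ) * Real.exp (-u)) -
      Real.exp (-v) * ∑' n : ℕ, c n * Real.exp (-(n : ℝ) * Real.exp (-v))| ≤
    12 * α * |u - v| := by
  have hα : 0 ≤ α := by
    have := (Finset.sum_nonneg fun i _ => abs_nonneg (c i)).trans (hS 1)
    simpa using this
  wlog huv : u ≤ v generalizing u v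
  · rw [abs_sub_comm, abs_sub_comm u]
    exact this v u (le_of_not_ge huv)
  rcases le_or_gt v (u + 1) with hv | hv
  · have he : 0 < Real.exp (-u) / 6 := by positivity
    obtain ⟨h1, h2⟩ := summable_and_tsum_exp_le (fun n => abs_nonneg (c n)) (β := 0)
      (by simpa using hS) he
    rw [← tsum_mul_left, ← tsum_mul_left,
      ← ((summable_exp_of_abs hS (Real.exp_pos _)).mul_left _).tsum_sub
        ((summable_exp_of_abs hS (Real.exp_pos _)).mul_left _)]
    refine (tsum_of_norm_bounded (E := ℝ) (h1.hasSum.mul_left (2 * Real.exp (-u) * |u - v|))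
      fun n => ?_).trans ?_
    · calc _ = |c n| * |Real.exp (-u) * Real.exp (-(n : ℝ) * Real.exp (-u)) -
            Real.exp (-v) * Real.exp (-(n : ℝ) * Real.exp (-v))| := by
            rw [Real.norm_eq_abs, ← abs_mul]; ring_nf
        _ ≤ |c n| * (2 * Real.exp (-u) * Real.exp (-(n : ℝ) * (Real.exp (-u) / 6)) * |u - v|) := by
            gcongr; exact abs_exp_neg_mul_exp_sub_le n huv hv
        _ = _ := by ring
    · have h3 := div_exp_sub_one_le he
      calc _ ≤ 2 * Real.exp (-u) * |u - v| * (α / (Real.exp (Real.exp (-u) / 6) - 1) + 0) := by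
            gcongr
        _ = 12 * α * |u - v| *
            ((Real.exp (-u) / 6) / (Real.exp (Real.exp (-u) / 6) - 1)) := by ring
        _ ≤ 12 * α * |u - v| * 1 := by gcongr
        _ = _ := mul_one _
  · have hb : ∀ w : ℝ, |Real.exp (-w) * ∑' n : ℕ, c n * Real.exp (-(n : ℝ) * Real.exp (-w))| ≤
        α := by
      intro w
      rw [abs_mul, Real.abs_exp]
      calc _ ≤ Real.exp (-w) * (α / (Real.exp (Real.exp (-w)) - 1)) := by
            gcongr; exact abs_tsum_exp_le hS (Real.exp_pos _)
        _ = α * (Real.exp (-w) / (Real.exp (Real.exp (-w)) - 1)) := by ring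
        _ ≤ α * 1 := by gcongr; exact div_exp_sub_one_le (Real.exp_pos _)
        _ = α := mul_one α
    have h1 : 1 ≤ |u - v| := by rw [abs_sub_comm, abs_of_nonneg] <;> linarith
    calc _ ≤ α + α := (abs_sub _ _).trans (add_le_add (hb u) (hb v))
      _ ≤ 12 * α * 1 := by linarith
      _ ≤ _ := by gcongr

open ArithmeticFunction in
/-- Dirichlet coefficients of minus the logarithmic derivative of `ζ`, minus `ζ`. -/
noncomputable def vonMangoldtSubOne (n : ℕ) : ℝ := if n = 0 then 0 else vonMangoldt n - 1

open ArithmeticFunction in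
lemma sum_vonMangoldt_le (n : ℕ) :
    ∑ i ∈ Finset.range (n + 1), vonMangoldt i ≤ (Real.log 4 + 4) * n := by
  have := Chebyshev.psi_le_const_mul_self (x := n) (by positivity)
  rwa [Chebyshev.psi_eq_sum_Icc, Nat.floor_natCast, ← Nat.range_succ_eq_Icc_zero] at this

lemma sum_abs_vonMangoldtSubOne_le (n : ℕ) :
    ∑ i ∈ Finset.range (n + 1), |vonMangoldtSubOne i| ≤ (Real.log 4 + 5) * n := by
  have h1 := sum_vonMangoldt_le n
  have h2 : ∑ i ∈ Finset.range (n + 1), (if i = 0 then (0 : ℝ) else 1) = n := by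
    simp [Finset.sum_range_succ']
  calc _ ≤ ∑ i ∈ Finset.range (n + 1), (ArithmeticFunction.vonMangoldt i +
        if i = 0 then (0 : ℝ) else 1) := by
        refine Finset.sum_le_sum fun i _ => ?_
        have : 0 ≤ ArithmeticFunction.vonMangoldt i := ArithmeticFunction.vonMangoldt_nonneg
        unfold vonMangoldtSubOne
        split_ifs
        · simp [this]
        · rw [abs_le]; constructor <;> linarith
    _ ≤ _ := by rw [Finset.sum_add_distrib, h2]; linarith

/-- Minus the logarithmic derivative of `ζ`, minus `ζ`, continued across the removable singularity
at `1`. -/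
noncomputable def logDerivZetaDefect (s : ℂ) : ℂ :=
  -(deriv riemannZeta₁ s / riemannZeta₁ s) - riemannZeta₀ s

lemma riemannZeta₁_ne_zero {s : ℂ} (hs : 1 ≤ s.re) : riemannZeta₁ s ≠ 0 := by
  rcases eq_or_ne s 1 with rfl | h1
  · simp
  · have := riemannZeta_ne_zero_of_one_le_re hs
    rw [riemannZeta_eq_inv_sub_mul h1] at this
    exact right_ne_zero_of_mul this

lemma continuousOn_logDerivZetaDefect : ContinuousOn logDerivZetaDefect {s | 1 ≤ s.re} := by
  have h : Continuous (deriv riemannZeta₁) :=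
    (differentiable_riemannZeta₁.contDiff (n := 1)).continuous_deriv le_rfl
  exact ((h.continuousOn.div differentiable_riemannZeta₁.continuous.continuousOn
    fun s hs => riemannZeta₁_ne_zero hs).neg).sub differentiable_riemannZeta₀.continuous.continuousOn

lemma logDerivZetaDefect_eq {s : ℂ} (hs : 1 < s.re) :
    logDerivZetaDefect s = -deriv riemannZeta s / riemannZeta s - riemannZeta s := by
  have h1 : s ≠ 1 := by rintro rfl; simp at hs
  have h2 := sub_ne_zero.2 h1
  have h3 := riemannZeta₁_ne_zero hs.le
  rw [deriv_riemannZeta_eq_neg_inv_sub_sq_mul_add h1]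
  nth_rw 2 [riemannZeta_eq_inv_sub_add h1]
  rw [riemannZeta_eq_inv_sub_mul h1, logDerivZetaDefect]
  field_simp
  ring

lemma LSeriesHasSum_vonMangoldtSubOne {s : ℂ} (hs : 1 < s.re) :
    LSeriesHasSum (fun n => (vonMangoldtSubOne n : ℂ)) s (logDerivZetaDefect s) := by
  have h1 := (ArithmeticFunction.LSeriesSummable_vonMangoldt hs).LSeriesHasSum
  rw [ArithmeticFunction.LSeries_vonMangoldt_eq_deriv_riemannZeta_div hs] at h1
  have h2 := LSeriesHasSum_one hs
  have := h1.sub h2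
  rw [← logDerivZetaDefect_eq hs] at this
  refine (LSeriesHasSum_congr s _ fun {n} hn => ?_).1 this
  simp [vonMangoldtSubOne, hn]

lemma mellin_vonMangoldtSubOne {s : ℂ} (hs : 1 < s.re) :
    mellin (fun t => ((∑' n : ℕ, vonMangoldtSubOne n * Real.exp (-(n : ℝ) * t) : ℝ) : ℂ)) s =
      Complex.Gamma s * logDerivZetaDefect s := by
  have hL := LSeriesHasSum_vonMangoldtSubOne hs
  have h0 : vonMangoldtSubOne 0 = 0 := by simp [vonMangoldtSubOne]
  have hm := hasSum_mellin (a := fun n : ℕ => (vonMangoldtSubOne n : ℂ)) (p := fun n : ℕ => (n : ℝ))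
    (F := fun t => ((∑' n : ℕ, vonMangoldtSubOne n * Real.exp (-(n : ℝ) * t) : ℝ) : ℂ)) (s := s)
    (fun n => ?_) (by linarith) (fun t ht => ?_) ?_
  · refine hm.unique ((hL.mul_left (Complex.Gamma s)).congr_fun fun n => ?_)
    rw [LSeries.term_def₀ (by simp [h0]), Complex.cpow_neg]
    simp only [Complex.ofReal_natCast]
    ring
  · rcases n.eq_zero_or_pos with rfl | hn
    · left; simp [h0]
    · right; exact_mod_cast hn
  · have := (summable_exp_of_abs sum_abs_vonMangoldtSubOne_le ht).hasSum
    refine (this.mapL Complex.ofRealCLM).congr_fun fun n => ?_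
    simp only [Complex.ofRealCLM_apply, Complex.ofReal_mul]
  · refine hL.LSeriesSummable.norm.congr fun n => ?_
    rw [LSeries.norm_term_eq]
    split_ifs with hn
    · simp [hn, h0]
    · rfl

lemma tendsto_mul_tsum_vonMangoldtSubOne :
    Tendsto (fun t : ℝ => t * ∑' n : ℕ, vonMangoldtSubOne n * Real.exp (-(n : ℝ) * t))
      (𝓝[>] 0) (𝓝 0) := by
  set P : ℝ → ℝ := fun t => ∑' n : ℕ, vonMangoldtSubOne n * Real.exp (-(n : ℝ) * t) with hP
  set α := Real.log 4 + 5 with hα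
  have hα0 : 0 ≤ α := by positivity
  have hbd : ∀ u : ℝ, |Real.exp (-u) * P (Real.exp (-u))| ≤
      α * (Real.exp (-u) / (Real.exp (Real.exp (-u)) - 1)) := by
    intro u
    rw [abs_mul, Real.abs_exp]
    calc _ ≤ Real.exp (-u) * (α / (Real.exp (Real.exp (-u)) - 1)) := by
          gcongr; exact abs_tsum_exp_le sum_abs_vonMangoldtSubOne_le (Real.exp_pos _)
      _ = _ := by ring
  have hLip := abs_smoothed_sub_le sum_abs_vonMangoldtSubOne_le
  have hcont : Continuous fun u : ℝ => Real.exp (-u) * P (Real.exp (-u)) := by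
    refine (LipschitzWith.of_dist_le_mul (K := (12 * α).toNNReal) fun u v => ?_).continuous
    rw [Real.coe_toNNReal _ (by positivity)]
    exact hLip u v
  have key : Tendsto (fun u : ℝ => ((Real.exp (-u) * P (Real.exp (-u)) : ℝ) : ℂ)) atTop (𝓝 0) := by
    refine tendsto_zero_of_fourier_boundary (C := 2 * α) (K := 12 * α)
      (G := fun s => Complex.Gamma s * logDerivZetaDefect s)
      (Complex.continuous_ofReal.comp hcont) (fun u => ?_) (fun u => ?_) (fun u v => ?_) ?_ ?_
    · rw [Complex.norm_real]
      refine (hbd u).trans ?_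
      have := div_exp_sub_one_le (Real.exp_pos (-u))
      nlinarith
    · rw [Complex.norm_real]
      refine (hbd u).trans ?_
      have := div_exp_sub_one_le_two_div (Real.exp_pos (-u))
      calc _ ≤ α * (2 / Real.exp (-u)) := by gcongr
        _ = _ := by rw [Real.exp_neg]; field_simp
    · rw [← Complex.ofReal_sub, Complex.norm_real]
      exact hLip u v
    · refine ContinuousOn.mul (fun s hs => ?_) continuousOn_logDerivZetaDefect
      refine (Complex.differentiableAt_Gamma s fun m hm => ?_).continuousAt.continuousWithinAt
      have h1 : 1 ≤ s.re := hs
      rw [hm] at h1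
      simp at h1
      have : (0 : ℝ) ≤ m := m.cast_nonneg
      linarith
    · intro δ hδ _ y
      rw [← mellin_vonMangoldtSubOne (by simpa using hδ), mellin_eq_fourier]
      have : 2 * Real.pi * y / (2 * Real.pi) = y := by field_simp
      simp only [this]
      refine congrArg (fun g : ℝ → ℂ => 𝓕 g y) (funext fun u => ?_)
      simp only [Complex.real_smul, Complex.ofReal_mul]
      rw [← mul_assoc, ← Complex.ofReal_mul, ← Real.exp_add]
      congr 3
      ring
  have key' : Tendsto (fun u : ℝ => Real.exp (-u) * P (Real.exp (-u))) atTop (𝓝 0) := by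
    exact (Complex.continuous_re.tendsto 0).comp key
  refine (key'.comp (tendsto_neg_atBot_atTop.comp Real.tendsto_log_nhdsGT_zero)).congr' ?_
  filter_upwards [self_mem_nhdsWithin] with t ht
  simp only [Function.comp_apply, neg_neg, Real.exp_log ht, hP]

lemma tendsto_div_exp_sub_one : Tendsto (fun t : ℝ => t / (Real.exp t - 1)) (𝓝[>] 0) (𝓝 1) := by
  have h := (hasDerivAt_iff_tendsto_slope.1 (Real.hasDerivAt_exp 0)).inv₀ (by simp)
  have h' := h.mono_left (nhdsWithin_mono (0 : ℝ) fun t (ht : t ∈ Set.Ioi 0) => ne_of_gt ht)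
  simp only [Real.exp_zero, inv_one] at h'
  refine h'.congr fun t => ?_
  simp [slope_def_field]

/-- Abelian form of the prime number theorem. -/
lemma tendsto_mul_tsum_vonMangoldt :
    Tendsto (fun t : ℝ => t * ∑' n : ℕ, ArithmeticFunction.vonMangoldt n *
      Real.exp (-(n : ℝ) * t)) (𝓝[>] 0) (𝓝 1) := by
  have h := tendsto_mul_tsum_vonMangoldtSubOne.add
    (tendsto_div_exp_sub_one.add ((tendsto_id.mono_left nhdsWithin_le_nhds).const_mul 0))
  simp only [zero_mul, add_zero, zero_add] at h
  refine h.congr' ?_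
  filter_upwards [self_mem_nhdsWithin] with t (ht : 0 < t)
  have h1 := summable_exp_of_abs sum_abs_vonMangoldtSubOne_le ht
  have h2 := hasSum_nat_mul_exp ht 0 1
  have h3 : HasSum (fun n : ℕ => (if n = 0 then 0 else 1) * Real.exp (-(n : ℝ) * t))
      (1 / (Real.exp t - 1)) := by
    have := (hasSum_ite_eq (0 : ℕ) (1 : ℝ))
    have h4 := h2.sub this
    have hne : Real.exp t - 1 ≠ 0 := by
      have := Real.add_one_lt_exp ht.ne'
      linarith
    have h5 : (0 / (Real.exp t - 1) + 1) / (1 - Real.exp (-t)) - 1 = 1 / (Real.exp t - 1) := by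
      have h3 : 1 - Real.exp (-t) = (Real.exp t - 1) / Real.exp t := by
        rw [Real.exp_neg]; field_simp
      rw [h3]
      field_simp
      ring
    rw [h5] at h4
    refine h4.congr_fun fun n => ?_
    split_ifs with hn <;> simp [hn]
  rw [show t / (Real.exp t - 1) = t * (1 / (Real.exp t - 1)) by ring, ← h3.tsum_eq, ← mul_add,
    ← h1.tsum_add h3.summable]
  congr 1
  refine tsum_congr fun n => ?_
  rw [← add_mul]
  congr 1
  unfold vonMangoldtSubOne
  split_ifs with hn <;> simp [hn]

lemma sum_range_vonMangoldt_sub_log_le {ε : ℝ} (hε : 0 < ε) : ∃ β : ℝ, ∀ n : ℕ,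
    ∑ i ∈ Finset.range (n + 1), (ArithmeticFunction.vonMangoldt i -
      if Nat.Prime i ∧ Odd i then Real.log i else 0) ≤ ε * n + β := by
  obtain ⟨C, hC⟩ := Chebyshev.psi_sub_theta_le_mul_sqrt
  refine ⟨C ^ 2 / (4 * ε) + Real.log 2, fun n => ?_⟩
  have hpsi : ∑ i ∈ Finset.range (n + 1), ArithmeticFunction.vonMangoldt i = Chebyshev.psi n := by
    rw [Chebyshev.psi_eq_sum_Icc, Nat.floor_natCast, ← Nat.range_succ_eq_Icc_zero]
  have hth : Chebyshev.theta n = ∑ i ∈ Finset.range (n + 1),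
      if Nat.Prime i then Real.log i else 0 := by
    rw [Chebyshev.theta_eq_sum_Icc, Nat.floor_natCast, ← Nat.range_succ_eq_Icc_zero,
      Finset.sum_filter]
  have hodd : (∑ i ∈ Finset.range (n + 1), if Nat.Prime i then Real.log i else 0) ≤
      (∑ i ∈ Finset.range (n + 1), if Nat.Prime i ∧ Odd i then Real.log i else 0) +
        Real.log 2 := by
    calc _ ≤ ∑ i ∈ Finset.range (n + 1), ((if Nat.Prime i ∧ Odd i then Real.log i else 0) +
          if i = 2 then Real.log 2 else 0) := by
          refine Finset.sum_le_sum fun i _ => ?_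
          by_cases hi : Nat.Prime i
          · rcases hi.eq_two_or_odd' with rfl | ho
            · simp [show ¬ Odd 2 by decide, Nat.prime_two]
            · have : i ≠ 2 := by rintro rfl; exact absurd ho (by decide)
              simp [hi, ho, this]
          · have : i ≠ 2 := by rintro rfl; exact hi Nat.prime_two
            simp [hi, this]
      _ ≤ _ := by
          rw [Finset.sum_add_distrib, Finset.sum_ite_eq']
          have := Real.log_nonneg (one_le_two (α := ℝ))
          split_ifs <;> linarith
  have hs : C * Real.sqrt n ≤ ε * n + C ^ 2 / (4 * ε) := by
    have h2 := Real.sq_sqrt (n.cast_nonneg (α := ℝ))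
    have h3 : ε * n + C ^ 2 / (4 * ε) - C * Real.sqrt n =
        (2 * ε * Real.sqrt n - C) ^ 2 / (4 * ε) := by
      nth_rw 1 [← h2]
      field_simp
      ring
    have : 0 ≤ (2 * ε * Real.sqrt n - C) ^ 2 / (4 * ε) := by positivity
    linarith
  have := hC n
  rw [Finset.sum_sub_distrib, hpsi]
  linarith

lemma ite_prime_log_nonneg (n : ℕ) : 0 ≤ if Nat.Prime n ∧ Odd n then Real.log n else 0 := by
  split_ifs
  · exact Real.log_natCast_nonneg n
  · rfl

lemma ite_prime_log_le_vonMangoldt (n : ℕ) :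
    (if Nat.Prime n ∧ Odd n then Real.log n else 0) ≤ ArithmeticFunction.vonMangoldt n := by
  split_ifs with h
  · rw [ArithmeticFunction.vonMangoldt_apply_prime h.1]
  · exact ArithmeticFunction.vonMangoldt_nonneg

lemma summable_vonMangoldt_mul_exp {t : ℝ} (ht : 0 < t) :
    Summable fun n : ℕ => ArithmeticFunction.vonMangoldt n * Real.exp (-(n : ℝ) * t) :=
  (summable_and_tsum_exp_le (fun _ => ArithmeticFunction.vonMangoldt_nonneg) (β := 0)
    (by simpa using sum_vonMangoldt_le) ht).1

lemma summable_prime_log_mul_exp {t : ℝ} (ht : 0 < t) :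
    Summable fun n : ℕ => (if Nat.Prime n ∧ Odd n then Real.log n else 0) *
      Real.exp (-(n : ℝ) * t) :=
  .of_nonneg_of_le (fun n => mul_nonneg (ite_prime_log_nonneg n) (Real.exp_pos _).le)
    (fun n => mul_le_mul_of_nonneg_right (ite_prime_log_le_vonMangoldt n) (Real.exp_pos _).le)
    (summable_vonMangoldt_mul_exp ht)

/-- Abelian form of the prime number theorem, for odd primes weighted by their logarithm. -/
lemma tendsto_mul_tsum_prime_log :
    Tendsto (fun t : ℝ => t * ∑' n : ℕ, (if Nat.Prime n ∧ Odd n then Real.log n else 0) *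
      Real.exp (-(n : ℝ) * t)) (𝓝[>] 0) (𝓝 1) := by
  have hdiff : Tendsto (fun t : ℝ => t * ∑' n : ℕ, (ArithmeticFunction.vonMangoldt n -
      if Nat.Prime n ∧ Odd n then Real.log n else 0) * Real.exp (-(n : ℝ) * t))
      (𝓝[>] 0) (𝓝 0) := by
    rw [Metric.tendsto_nhds]
    intro ε hε
    obtain ⟨β, hβ⟩ := sum_range_vonMangoldt_sub_log_le (half_pos hε)
    have hlim : Tendsto (fun t : ℝ => ε / 2 + β * t) (𝓝[>] 0) (𝓝 (ε / 2)) := by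
      have : Continuous fun t : ℝ => ε / 2 + β * t := by fun_prop
      simpa using (this.tendsto 0).mono_left nhdsWithin_le_nhds
    filter_upwards [self_mem_nhdsWithin, hlim.eventually_lt_const (half_lt_self hε)] with t
      (ht : 0 < t) hlt
    have hn : ∀ n : ℕ, 0 ≤ ArithmeticFunction.vonMangoldt n -
        if Nat.Prime n ∧ Odd n then Real.log n else 0 := fun n =>
      sub_nonneg.2 (ite_prime_log_le_vonMangoldt n)
    have h1 := (summable_and_tsum_exp_le hn hβ ht).2
    have h2 : 0 ≤ ∑' n : ℕ, (ArithmeticFunction.vonMangoldt n -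
        if Nat.Prime n ∧ Odd n then Real.log n else 0) * Real.exp (-(n : ℝ) * t) :=
      tsum_nonneg fun n => mul_nonneg (hn n) (Real.exp_pos _).le
    rw [Real.dist_eq, sub_zero, abs_of_nonneg (by positivity)]
    refine lt_of_le_of_lt ?_ hlt
    calc _ ≤ t * (ε / 2 / (Real.exp t - 1) + β) := by gcongr
      _ = ε / 2 * (t / (Real.exp t - 1)) + β * t := by ring
      _ ≤ ε / 2 * 1 + β * t := by gcongr; exact div_exp_sub_one_le ht
      _ = _ := by ring
  have h := tendsto_mul_tsum_vonMangoldt.sub hdiff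
  rw [sub_zero] at h
  refine h.congr' ?_
  filter_upwards [self_mem_nhdsWithin] with t (ht : 0 < t)
  have hs := (summable_vonMangoldt_mul_exp ht).tsum_sub (summable_prime_log_mul_exp ht)
  simp_rw [sub_mul]
  rw [hs]
  ring

lemma hasSum_f_exp_neg {t : ℝ} (ht : 0 < t) :
    HasSum (fun n : ℕ => (if Nat.Prime n ∧ Odd n then (1 : ℝ) else 0) * Real.exp (-(n : ℝ) * t))
      (f (Real.exp (-t))) := by
  have hs : Summable fun n : ℕ => (if Nat.Prime n ∧ Odd n then (1 : ℝ) else 0) *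
      Real.exp (-(n : ℝ) * t) := by
    refine .of_nonneg_of_le (fun n => ?_) (fun n => ?_) (hasSum_nat_mul_exp ht 0 1).summable
    · split_ifs <;> positivity
    · gcongr
      split_ifs <;> simp
  convert hs.hasSum using 1
  refine tsum_congr fun n => ?_
  rw [← Real.exp_nat_mul]
  split_ifs
  · rw [one_mul]; ring_nf
  · simp

/-- Bounds `log n` by `log (1 / t) + log A` up to an error linear in `n * t / A`. -/
lemma mul_tsum_prime_log_le {t A : ℝ} (ht : 0 < t) (hA : 0 < A) :
    t * ∑' n : ℕ, (if Nat.Prime n ∧ Odd n then Real.log n else 0) * Real.exp (-(n : ℝ) * t) ≤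
      (Real.log (1 / t) + Real.log A) * (t * f (Real.exp (-t))) + 4 / A := by
  have hf := hasSum_f_exp_neg ht
  have hS : ∀ n : ℕ, ∑ i ∈ Finset.range (n + 1), (if i = 0 then (0 : ℝ) else 1) ≤ 1 * n + 0 := by
    intro n
    simp [Finset.sum_range_succ']
  obtain ⟨h1, h2⟩ := summable_and_tsum_exp_le
    (fun n => by split_ifs <;> simp) hS (half_pos ht)
  have hle : ∀ n : ℕ, (if Nat.Prime n ∧ Odd n then Real.log n else 0) * Real.exp (-(n : ℝ) * t) ≤
      (Real.log (1 / t) + Real.log A) *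
        ((if Nat.Prime n ∧ Odd n then (1 : ℝ) else 0) * Real.exp (-(n : ℝ) * t)) +
      2 / A * ((if n = 0 then (0 : ℝ) else 1) * Real.exp (-(n : ℝ) * (t / 2))) := by
    intro n
    split_ifs with hp hn hn
    · simp [hn] at hp
    · have hn0 : (0 : ℝ) < n := by exact_mod_cast Nat.pos_of_ne_zero hn
      set y := (n : ℝ) * t with hy
      have hy0 : 0 < y := by positivity
      have hlog : Real.log n = Real.log (1 / t) + Real.log A + Real.log (y / A) := by
        rw [hy, one_div, Real.log_inv, Real.log_div (by positivity) hA.ne',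
          Real.log_mul hn0.ne' ht.ne']
        ring
      have h3 : Real.log (y / A) ≤ y / A := (Real.log_le_sub_one_of_pos (by positivity)).trans
        (by linarith)
      have h4 : y ≤ 2 * Real.exp (y / 2) := by linarith [Real.add_one_le_exp (y / 2)]
      have h5 : Real.exp (-(n : ℝ) * t) = Real.exp (-y) := by rw [hy]; ring_nf
      have h6 : Real.exp (-(n : ℝ) * (t / 2)) = Real.exp (y / 2) * Real.exp (-y) := by
        rw [← Real.exp_add, hy]; ring_nf
      rw [h5, h6, hlog]
      calc _ = (Real.log (1 / t) + Real.log A) * (1 * Real.exp (-y)) +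
            Real.log (y / A) * Real.exp (-y) := by ring
        _ ≤ (Real.log (1 / t) + Real.log A) * (1 * Real.exp (-y)) +
            (2 * Real.exp (y / 2)) / A * Real.exp (-y) := by
            gcongr
            exact h3.trans (by gcongr)
        _ = _ := by ring
    · simp
    · simp only [zero_mul, mul_zero, zero_add]
      positivity
  have h := (summable_prime_log_mul_exp ht).tsum_le_tsum hle
    ((hf.summable.mul_left _).add (h1.mul_left _))
  rw [(hf.summable.mul_left _).tsum_add (h1.mul_left _), tsum_mul_left, tsum_mul_left,
    hf.tsum_eq] at h
  have h7 := div_exp_sub_one_le (half_pos ht)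
  calc _ ≤ t * ((Real.log (1 / t) + Real.log A) * f (Real.exp (-t)) +
        2 / A * (1 / (Real.exp (t / 2) - 1) + 0)) := by
        gcongr
        refine h.trans ?_
        gcongr
    _ = (Real.log (1 / t) + Real.log A) * (t * f (Real.exp (-t))) +
        4 / A * (t / 2 / (Real.exp (t / 2) - 1)) := by ring
    _ ≤ (Real.log (1 / t) + Real.log A) * (t * f (Real.exp (-t))) + 4 / A * 1 := by gcongr
    _ = _ := by ring

/-- Counts the primes up to `X` trivially and bounds `1` by `log p / log X` beyond. -/
lemma f_exp_neg_le {t X : ℝ} (ht : 0 < t) (hX : 1 < X) :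
    f (Real.exp (-t)) ≤ (X + 1) + (Real.log X)⁻¹ *
      ∑' n : ℕ, (if Nat.Prime n ∧ Odd n then Real.log n else 0) * Real.exp (-(n : ℝ) * t) := by
  have hlX := Real.log_pos hX
  have hf := hasSum_f_exp_neg ht
  set N := ⌊X⌋₊ + 1 with hN
  have hfin : HasSum (fun n : ℕ => if n ∈ Finset.range N then (1 : ℝ) else 0) N := by
    have := hasSum_sum_of_ne_finset_zero (L := .unconditional ℕ)
      (f := fun n : ℕ => if n ∈ Finset.range N then (1 : ℝ) else 0) (s := Finset.range N)
      fun n hn => if_neg hn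
    rwa [Finset.sum_congr rfl (fun n hn => if_pos hn), Finset.sum_const, Finset.card_range,
      nsmul_one] at this
  have hle : ∀ n : ℕ, (if Nat.Prime n ∧ Odd n then (1 : ℝ) else 0) * Real.exp (-(n : ℝ) * t) ≤
      (if n ∈ Finset.range N then (1 : ℝ) else 0) + (Real.log X)⁻¹ *
        ((if Nat.Prime n ∧ Odd n then Real.log n else 0) * Real.exp (-(n : ℝ) * t)) := by
    intro n
    have h0 := mul_nonneg (inv_nonneg.2 hlX.le)
      (mul_nonneg (ite_prime_log_nonneg n) (Real.exp_pos (-(n : ℝ) * t)).le)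
    by_cases hn : n ∈ Finset.range N
    · have h1 : Real.exp (-(n : ℝ) * t) ≤ 1 := Real.exp_le_one_iff.2 (by
        have : 0 ≤ (n : ℝ) * t := by positivity
        linarith)
      have h2 : (if Nat.Prime n ∧ Odd n then (1 : ℝ) else 0) * Real.exp (-(n : ℝ) * t) ≤ 1 := by
        split_ifs
        · rwa [one_mul]
        · simp
      rw [if_pos hn]
      linarith
    · rw [if_neg hn, zero_add]
      have hXn : X ≤ n := by
        rw [Finset.mem_range, not_lt, hN] at hn
        exact (Nat.lt_floor_add_one X).le.trans (by exact_mod_cast hn)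
      split_ifs
      · rw [← mul_assoc]
        gcongr
        rw [inv_mul_eq_div, one_le_div hlX]
        exact Real.log_le_log (by linarith) hXn
      · simp
  have hL := summable_prime_log_mul_exp ht
  have h := hf.summable.tsum_le_tsum hle (hfin.summable.add (hL.mul_left _))
  rw [hf.tsum_eq, hfin.summable.tsum_add (hL.mul_left _), hfin.tsum_eq, tsum_mul_left] at h
  refine h.trans ?_
  gcongr
  rw [hN]
  push_cast
  gcongr
  exact Nat.floor_le (by linarith)

lemma tendsto_log_one_div : Tendsto (fun t : ℝ => Real.log (1 / t)) (𝓝[>] 0) atTop := by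
  simpa [Function.comp_def] using tendsto_neg_atBot_atTop.comp Real.tendsto_log_nhdsGT_zero

lemma f_exp_neg_asymptotic :
    Tendsto (fun t : ℝ => t * Real.log (1 / t) * f (Real.exp (-t))) (𝓝[>] 0) (𝓝 1) := by
  have hG := tendsto_mul_tsum_prime_log
  have hL := tendsto_log_one_div
  rw [tendsto_order]
  constructor
  · intro a ha
    obtain ⟨A, hA0, hA⟩ : ∃ A : ℝ, 0 < A ∧ a < 1 - 4 / A := by
      have h : Tendsto (fun A : ℝ => 1 - 4 / A) atTop (𝓝 (1 - 0)) :=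
        (tendsto_id.const_div_atTop (4 : ℝ)).const_sub 1
      rw [sub_zero] at h
      exact ((eventually_gt_atTop 0).and (h.eventually_const_lt ha)).exists
    have hlim : Tendsto (fun t : ℝ => ((t * ∑' n : ℕ,
        (if Nat.Prime n ∧ Odd n then Real.log n else 0) * Real.exp (-(n : ℝ) * t)) - 4 / A) /
        (1 + Real.log A / Real.log (1 / t))) (𝓝[>] 0) (𝓝 (1 - 4 / A)) := by
      have h := (hG.sub_const (4 / A)).div ((hL.const_div_atTop (Real.log A)).const_add 1)
        (by norm_num)
      rw [add_zero, div_one] at h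
      exact h
    filter_upwards [hlim.eventually_const_lt hA, self_mem_nhdsWithin, hL.eventually_gt_atTop 0,
      hL.eventually_gt_atTop (-Real.log A)] with t h1 (ht : 0 < t) h2 h3
    refine h1.trans_le ?_
    have h4 : 1 + Real.log A / Real.log (1 / t) =
        (Real.log (1 / t) + Real.log A) / Real.log (1 / t) := by field_simp
    rw [h4, div_le_iff₀ (div_pos (by linarith) h2)]
    have h5 := mul_tsum_prime_log_le ht hA0
    calc _ ≤ (Real.log (1 / t) + Real.log A) * (t * f (Real.exp (-t))) := by linarith
      _ = _ := by field_simp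
  · intro b hb
    obtain ⟨η, hη0, hη1, hη⟩ : ∃ η : ℝ, 0 < η ∧ η < 1 ∧ η⁻¹ < b := by
      have h : Tendsto (fun η : ℝ => η⁻¹) (𝓝[<] 1) (𝓝 1) := by
        simpa using (tendsto_inv₀ (one_ne_zero (α := ℝ))).mono_left nhdsWithin_le_nhds
      have hI : ∀ᶠ η : ℝ in 𝓝[<] 1, 0 < η ∧ η < 1 := Ioo_mem_nhdsLT one_pos
      obtain ⟨η, h1, h2⟩ := (hI.and (h.eventually_lt_const hb)).exists
      exact ⟨η, h1.1, h1.2, h2⟩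
    have hexp : Tendsto (fun t : ℝ => t * Real.log (1 / t) * (Real.exp (η * Real.log (1 / t)) + 1))
        (𝓝[>] 0) (𝓝 0) := by
      have h1 : Tendsto (fun x : ℝ => x ^ (1 : ℝ) * Real.exp (-(1 - η) * x)) atTop (𝓝 0) :=
        tendsto_rpow_mul_exp_neg_mul_atTop_nhds_zero 1 _ (by linarith)
      have h2 : Tendsto (fun x : ℝ => x ^ 1 * Real.exp (-x)) atTop (𝓝 0) :=
        Real.tendsto_pow_mul_exp_neg_atTop_nhds_zero 1
      have h3 := (h1.add h2).comp hL
      rw [add_zero] at h3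
      refine h3.congr' ?_
      filter_upwards [self_mem_nhdsWithin] with t (ht : 0 < t)
      have h4 : Real.exp (-Real.log (1 / t)) = t := by
        rw [one_div, Real.log_inv, neg_neg, Real.exp_log ht]
      have h5 : Real.exp (-(1 - η) * Real.log (1 / t)) = t * Real.exp (η * Real.log (1 / t)) := by
        rw [show -(1 - η) * Real.log (1 / t) = -Real.log (1 / t) + η * Real.log (1 / t) by ring,
          Real.exp_add, h4]
      simp only [Function.comp_apply, pow_one, Real.rpow_one, h4, h5]
      ring
    have hlim := hexp.add (hG.const_mul η⁻¹)
    rw [zero_add, mul_one] at hlim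
    filter_upwards [hlim.eventually_lt_const hη, self_mem_nhdsWithin, hL.eventually_gt_atTop 0]
      with t h1 (ht : 0 < t) h2
    refine lt_of_le_of_lt ?_ h1
    have h3 := f_exp_neg_le ht (X := Real.exp (η * Real.log (1 / t)))
      (Real.one_lt_exp_iff.2 (by positivity))
    rw [Real.log_exp] at h3
    refine (mul_le_mul_of_nonneg_left h3 (by positivity)).trans_eq ?_
    field_simp

theorem f_asymptotic_t_and_z :
    Tendsto (fun t : ℝ => t * Real.log (1 / t) * f (Real.exp (-t))) (𝓝[>] 0) (𝓝 1) ∧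
    Tendsto (fun z : ℝ => Real.log (1 / z) * Real.log (Real.log (1 / z)) * f z)
      (𝓝[<] 1) (𝓝 (-1)) := by
  refine ⟨f_exp_neg_asymptotic, ?_⟩
  have hz : ∀ᶠ z : ℝ in 𝓝[<] 1, 0 < z ∧ z < 1 := Ioo_mem_nhdsLT one_pos
  have hlog : Tendsto (fun z : ℝ => Real.log (1 / z)) (𝓝[<] 1) (𝓝[>] 0) := by
    refine tendsto_nhdsWithin_iff.2 ⟨?_, ?_⟩
    · have h := (Real.continuousAt_log (one_ne_zero)).neg.tendsto.mono_left
        (nhdsWithin_le_nhds (s := Set.Iio 1))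
      simpa [Function.comp_def, Pi.neg_def] using h
    · filter_upwards [hz] with z hz
      exact Real.log_pos (one_lt_one_div hz.1 hz.2)
  refine (f_exp_neg_asymptotic.comp hlog).neg.congr' ?_
  filter_upwards [hz] with z hz
  have h1 : Real.exp (-Real.log (1 / z)) = z := by
    rw [one_div, Real.log_inv, neg_neg, Real.exp_log hz.1]
  simp only [Function.comp_apply, h1]
  rw [one_div (Real.log (1 / z)), Real.log_inv]
  ring
end

section
/- As z → 1⁻ (z real), f(z) ~ 1/((1−z)·log(1/(1−z))), i.e. (1−z)·log(1/(1−z))·f(z) → 1. -/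
open Filter Topology

open MeasureTheory Set

/-- The Fejér kernel `x ↦ (sin (x / 2) / (x / 2)) ^ 2`. -/
noncomputable def fejer (x : ℝ) : ℝ := Real.sinc (x / 2) ^ 2

lemma continuous_fejer : Continuous fejer := by
  unfold fejer
  fun_prop

lemma fejer_nonneg (x : ℝ) : 0 ≤ fejer x := sq_nonneg _

lemma fejer_zero : fejer 0 = 1 := by simp [fejer]

lemma fejer_eq {x : ℝ} (hx : x ≠ 0) : fejer x = 2 * (1 - Real.cos x) / x ^ 2 := by
  have h : Real.cos x = 1 - 2 * Real.sin (x / 2) ^ 2 := by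
    have h1 := Real.cos_two_mul (x / 2)
    have h2 := Real.sin_sq_add_cos_sq (x / 2)
    rw [mul_div_cancel₀ x two_ne_zero] at h1
    linarith
  rw [fejer, Real.sinc_of_ne_zero (by positivity), h]
  field_simp
  ring

lemma fejer_le (x : ℝ) : fejer x ≤ 5 * (1 + x ^ 2)⁻¹ := by
  rw [← div_eq_mul_inv, le_div_iff₀ (by positivity), mul_add, mul_one]
  have h1 : fejer x ≤ 1 := by
    rw [fejer, sq_le_one_iff_abs_le_one]
    exact Real.abs_sinc_le_one _
  have h2 : fejer x * x ^ 2 ≤ 4 := by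
    rcases eq_or_ne x 0 with rfl | hx
    · simp
    · rw [fejer_eq hx, div_mul_cancel₀ _ (by positivity)]
      linarith [Real.neg_one_le_cos x]
  linarith

lemma integrable_fejer : Integrable fejer :=
  (integrable_inv_one_add_sq.const_mul 5).mono' continuous_fejer.aestronglyMeasurable
    (ae_of_all _ fun x ↦ by
      rw [Real.norm_of_nonneg (fejer_nonneg x)]
      exact fejer_le x)

lemma integral_fejer_pos : 0 < ∫ x, fejer x := by
  rw [integral_pos_iff_support_of_nonneg fejer_nonneg integrable_fejer]
  exact continuous_fejer.isOpen_support.measure_pos _ ⟨0, by simp [fejer_zero]⟩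

/-- The Fejér kernel is the Fourier transform of the triangle function. -/
lemma integral_triangle_mul_exp (x : ℝ) :
    ∫ τ in (-1 : ℝ)..1, ((1 - |τ| : ℝ) : ℂ) * Complex.exp (τ * x * Complex.I) = fejer x := by
  have hcont : Continuous fun τ : ℝ ↦ ((1 - |τ| : ℝ) : ℂ) * Complex.exp (τ * x * Complex.I) := by
    fun_prop
  rw [← intervalIntegral.integral_add_adjacent_intervals (b := 0)
    (hcont.intervalIntegrable _ _) (hcont.intervalIntegrable _ _)]
  rcases eq_or_ne x 0 with rfl | hx
  · have h1 : ∫ τ in (-1 : ℝ)..0, ((1 - |τ| : ℝ) : ℂ) * Complex.exp (τ * (0 : ℝ) * Complex.I)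
        = ((∫ τ in (-1 : ℝ)..0, (1 + τ) : ℝ) : ℂ) := by
      rw [← intervalIntegral.integral_ofReal]
      refine intervalIntegral.integral_congr fun τ hτ ↦ ?_
      rw [uIcc_of_le (by norm_num)] at hτ
      simp [abs_of_nonpos hτ.2]
    have h2 : ∫ τ in (0 : ℝ)..1, ((1 - |τ| : ℝ) : ℂ) * Complex.exp (τ * (0 : ℝ) * Complex.I)
        = ((∫ τ in (0 : ℝ)..1, (1 - τ) : ℝ) : ℂ) := by
      rw [← intervalIntegral.integral_ofReal]
      refine intervalIntegral.integral_congr fun τ hτ ↦ ?_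
      rw [uIcc_of_le (by norm_num)] at hτ
      simp [abs_of_nonneg hτ.1]
    rw [h1, h2, fejer_zero, ← Complex.ofReal_add, Complex.ofReal_inj,
      intervalIntegral.integral_add (by simp) (by simp),
      intervalIntegral.integral_sub (by simp) (by simp)]
    norm_num [integral_id]
  · set c : ℂ := x * Complex.I with hc
    have hc0 : c ≠ 0 := by simp [hc, hx]
    have hE (τ : ℝ) : HasDerivAt (fun τ : ℝ ↦ Complex.exp (τ * x * Complex.I))
        (Complex.exp (τ * x * Complex.I) * c) τ := by
      have := ((Complex.ofRealCLM.hasDerivAt (x := τ)).mul_const c).cexp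
      simpa [hc, mul_assoc] using this
    have hI (τ : ℝ) : HasDerivAt (fun τ : ℝ ↦ (τ : ℂ)) 1 τ := by
      simpa using (hasDerivAt_id τ).ofReal_comp
    have h1 : ∫ τ in (-1 : ℝ)..0, ((1 - |τ| : ℝ) : ℂ) * Complex.exp (τ * x * Complex.I)
        = 1 / c - 1 / c ^ 2 + Complex.exp (-c) / c ^ 2 := by
      have hd (τ : ℝ) : HasDerivAt (fun τ : ℝ ↦ (1 + (τ : ℂ)) *
          (Complex.exp (τ * x * Complex.I) / c) - Complex.exp (τ * x * Complex.I) / c ^ 2)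
          ((1 + (τ : ℂ)) * Complex.exp (τ * x * Complex.I)) τ := by
        convert! (((hI τ).const_add 1).mul ((hE τ).div_const c)).sub ((hE τ).div_const (c ^ 2))
          using 1
        field_simp
        ring
      rw [intervalIntegral.integral_congr
        (g := fun τ : ℝ ↦ (1 + (τ : ℂ)) * Complex.exp (τ * x * Complex.I)),
        intervalIntegral.integral_eq_sub_of_hasDerivAt (fun τ _ ↦ hd τ)
          ((by fun_prop : Continuous _).intervalIntegrable _ _)]
      · simp [hc]
      · intro τ hτ
        rw [uIcc_of_le (by norm_num)] at hτ
        simp [abs_of_nonpos hτ.2]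
    have h2 : ∫ τ in (0 : ℝ)..1, ((1 - |τ| : ℝ) : ℂ) * Complex.exp (τ * x * Complex.I)
        = Complex.exp c / c ^ 2 - 1 / c - 1 / c ^ 2 := by
      have hd (τ : ℝ) : HasDerivAt (fun τ : ℝ ↦ (1 - (τ : ℂ)) *
          (Complex.exp (τ * x * Complex.I) / c) + Complex.exp (τ * x * Complex.I) / c ^ 2)
          ((1 - (τ : ℂ)) * Complex.exp (τ * x * Complex.I)) τ := by
        convert! (((hI τ).const_sub 1).mul ((hE τ).div_const c)).add ((hE τ).div_const (c ^ 2))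
          using 1
        field_simp
        ring
      rw [intervalIntegral.integral_congr
        (g := fun τ : ℝ ↦ (1 - (τ : ℂ)) * Complex.exp (τ * x * Complex.I)),
        intervalIntegral.integral_eq_sub_of_hasDerivAt (fun τ _ ↦ hd τ)
          ((by fun_prop : Continuous _).intervalIntegrable _ _)]
      · simp [hc]
        ring
      · intro τ hτ
        rw [uIcc_of_le (by norm_num)] at hτ
        simp [abs_of_nonneg hτ.1]
    rw [h1, h2, fejer_eq hx]
    have hcos : Complex.exp c + Complex.exp (-c) = 2 * Complex.cos x := by
      rw [Complex.cos, hc]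
      ring_nf
    have hc2 : c ^ 2 = -(x : ℂ) ^ 2 := by
      rw [hc, mul_pow, Complex.I_sq]
      ring
    have hx' : (x : ℂ) ≠ 0 := by exact_mod_cast hx
    push_cast
    calc 1 / c - 1 / c ^ 2 + Complex.exp (-c) / c ^ 2
        + (Complex.exp c / c ^ 2 - 1 / c - 1 / c ^ 2)
        = (Complex.exp c + Complex.exp (-c) - 2) / c ^ 2 := by ring
      _ = 2 * (1 - Complex.cos x) / (x : ℂ) ^ 2 := by
        rw [hcos, hc2]
        field_simp
        ring

lemma integral_mul_exp_mul_fejer {a : ℝ → ℝ} (ha : Measurable a) {M : ℝ} (hM : ∀ u, |a u| ≤ M)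
    {H : ℂ → ℂ}
    (hH : ∀ w : ℂ, 0 < w.re → ∫ u in Ioi (0 : ℝ), (a u : ℂ) * Complex.exp (-w * u) = H w)
    {ε : ℝ} (hε : 0 < ε) (L y : ℝ) :
    ((∫ u in Ioi (0 : ℝ), a u * Real.exp (-ε * u) * fejer (L * (y - u)) : ℝ) : ℂ) =
      ∫ τ in (-1 : ℝ)..1, ((1 - |τ| : ℝ) : ℂ) * Complex.exp (τ * (L * y) * Complex.I) *
        H (ε + L * τ * Complex.I) := by
  set Φ : ℝ → ℝ → ℂ := fun u τ ↦ ((a u * Real.exp (-ε * u) : ℝ) : ℂ) * ((1 - |τ| : ℝ) : ℂ) *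
    Complex.exp (τ * (L * (y - u) : ℝ) * Complex.I) with hΦ
  have hint_a : Integrable (fun u ↦ a u * Real.exp (-ε * u)) (volume.restrict (Ioi 0)) :=
    (integrableOn_exp_mul_Ioi (neg_neg_of_pos hε) 0).bdd_mul ha.aestronglyMeasurable
      (ae_of_all _ hM)
  have hint_t : Integrable (fun τ : ℝ ↦ (1 - |τ| : ℝ)) (volume.restrict (Ioc (-1) 1)) :=
    (by fun_prop : Continuous fun τ : ℝ ↦ (1 - |τ| : ℝ)).integrableOn_Ioc
  have hInt : Integrable (Function.uncurry Φ)
      ((volume.restrict (Ioi 0)).prod (volume.restrict (Ioc (-1) 1))) := by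
    refine (hint_a.mul_prod hint_t).norm.mono' ?_ (ae_of_all _ fun p ↦ ?_)
    · have : Measurable (Function.uncurry Φ) := by
        simp only [hΦ, Function.uncurry_def]
        fun_prop
      exact this.aestronglyMeasurable
    · simp only [Function.uncurry_def, hΦ, norm_mul]
      rw [← Complex.ofReal_mul p.2, Complex.norm_exp_ofReal_mul_I]
      simp only [norm_mul, Complex.norm_real, mul_one, le_refl]
  calc ((∫ u in Ioi (0 : ℝ), a u * Real.exp (-ε * u) * fejer (L * (y - u)) : ℝ) : ℂ)
      = ∫ u in Ioi (0 : ℝ), ∫ τ in Ioc (-1 : ℝ) 1, Φ u τ := by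
        rw [← integral_complex_ofReal]
        congr 1 with u
        rw [Complex.ofReal_mul, ← integral_triangle_mul_exp,
          intervalIntegral.integral_of_le (by norm_num), ← integral_const_mul]
        simp [hΦ, mul_assoc]
    _ = ∫ τ in Ioc (-1 : ℝ) 1, ∫ u in Ioi (0 : ℝ), Φ u τ := integral_integral_swap hInt
    _ = _ := by
        rw [intervalIntegral.integral_of_le (by norm_num)]
        congr 1 with τ
        rw [← hH _ (by simpa using hε), ← integral_const_mul]
        congr 1 with u
        simp only [hΦ]
        push_cast
        rw [show -(ε + L * τ * Complex.I) * u = -ε * u + (-(L * τ * u * Complex.I)) by ring,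
          show (τ : ℂ) * (L * (y - u)) * Complex.I
            = τ * (L * y) * Complex.I + (-(L * τ * u * Complex.I)) by ring,
          Complex.exp_add, Complex.exp_add]
        ring

lemma integrable_fejer_comp {L : ℝ} (hL : 0 < L) (y : ℝ) :
    Integrable fun u ↦ fejer (L * (y - u)) :=
  (integrable_fejer.comp_mul_left' hL.ne').comp_sub_left y

lemma integral_mul_fejer {a : ℝ → ℝ} (ha : Measurable a) {M : ℝ} (hM : ∀ u, |a u| ≤ M)
    {H : ℂ → ℂ} (hc : ContinuousOn H {w | 0 ≤ w.re})
    (hH : ∀ w : ℂ, 0 < w.re → ∫ u in Ioi (0 : ℝ), (a u : ℂ) * Complex.exp (-w * u) = H w)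
    {L : ℝ} (hL : 0 < L) (y : ℝ) :
    ((∫ u in Ioi (0 : ℝ), a u * fejer (L * (y - u)) : ℝ) : ℂ) =
      ∫ τ in (-1 : ℝ)..1, ((1 - |τ| : ℝ) : ℂ) * Complex.exp (τ * (L * y) * Complex.I) *
        H (L * τ * Complex.I) := by
  have hlhs : Tendsto (fun ε : ℝ ↦
      ((∫ u in Ioi (0 : ℝ), a u * Real.exp (-ε * u) * fejer (L * (y - u)) : ℝ) : ℂ)) (𝓝[>] 0)
      (𝓝 ((∫ u in Ioi (0 : ℝ), a u * fejer (L * (y - u)) : ℝ) : ℂ)) := by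
    refine (Complex.continuous_ofReal.tendsto _).comp ?_
    refine tendsto_integral_filter_of_dominated_convergence
      (fun u ↦ M * fejer (L * (y - u))) ?_ ?_
      ((integrable_fejer_comp hL y).const_mul M).integrableOn ?_
    · refine Eventually.of_forall fun ε ↦ Measurable.aestronglyMeasurable ?_
      have := continuous_fejer.measurable
      fun_prop
    · filter_upwards [self_mem_nhdsWithin] with ε hε
      filter_upwards [ae_restrict_mem measurableSet_Ioi] with u hu
      rw [Real.norm_eq_abs, abs_mul, abs_mul, abs_of_nonneg (fejer_nonneg _), Real.abs_exp]
      have h1 : Real.exp (-ε * u) ≤ 1 := by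
        rw [Real.exp_le_one_iff]
        have := mul_pos (mem_Ioi.mp hε) (mem_Ioi.mp hu)
        linarith
      have := fejer_nonneg (L * (y - u))
      have h2 : |a u| * Real.exp (-ε * u) ≤ M * 1 :=
        mul_le_mul (hM u) h1 (Real.exp_nonneg _) ((abs_nonneg _).trans (hM u))
      rw [mul_one] at h2
      gcongr
    · refine ae_of_all _ fun u ↦ ?_
      have h : Tendsto (fun ε : ℝ ↦ a u * Real.exp (-ε * u) * fejer (L * (y - u))) (𝓝 0)
          (𝓝 (a u * Real.exp (-0 * u) * fejer (L * (y - u)))) :=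
        Continuous.tendsto (by fun_prop) 0
      simpa using h.mono_left nhdsWithin_le_nhds
  set K : Set ℂ := Icc 0 1 ×ℂ Icc (-L) L with hK
  have hKc : IsCompact K := isCompact_Icc.reProdIm isCompact_Icc
  have hKs : K ⊆ {w | 0 ≤ w.re} := fun w hw ↦ hw.1.1
  obtain ⟨B, hB⟩ := hKc.exists_bound_of_continuousOn (hc.mono hKs)
  have hmem {ε τ : ℝ} (hε : ε ∈ Icc (0 : ℝ) 1) (hτ : τ ∈ Ioc (-1 : ℝ) 1) :
      (ε + L * τ * Complex.I : ℂ) ∈ K := by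
    rw [hK, Complex.mem_reProdIm]
    refine ⟨by simpa using hε, ?_⟩
    simp only [Complex.add_im, Complex.ofReal_im, Complex.mul_im, Complex.I_im, Complex.I_re,
      Complex.mul_re, Complex.ofReal_re, zero_add, mul_zero, mul_one, add_zero, zero_mul, sub_zero,
      mem_Icc]
    constructor <;> nlinarith [hτ.1, hτ.2]
  have hrhs : Tendsto (fun ε : ℝ ↦ ∫ τ in (-1 : ℝ)..1, ((1 - |τ| : ℝ) : ℂ) *
      Complex.exp (τ * (L * y) * Complex.I) * H (ε + L * τ * Complex.I)) (𝓝[>] 0)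
      (𝓝 (∫ τ in (-1 : ℝ)..1, ((1 - |τ| : ℝ) : ℂ) * Complex.exp (τ * (L * y) * Complex.I) *
        H (L * τ * Complex.I))) := by
    simp_rw [intervalIntegral.integral_of_le (by norm_num : (-1 : ℝ) ≤ 1)]
    have hev : ∀ᶠ ε : ℝ in 𝓝[>] 0, ε ∈ Ioc (0 : ℝ) 1 := Ioc_mem_nhdsGT one_pos
    refine tendsto_integral_filter_of_dominated_convergence (fun _ ↦ B) ?_ ?_
      (integrable_const B) ?_
    · filter_upwards [hev] with ε hε
      refine ContinuousOn.aestronglyMeasurable ?_ measurableSet_Ioc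
      refine ContinuousOn.mul (by fun_prop) (hc.comp (by fun_prop) fun τ hτ ↦ ?_)
      exact hKs (hmem ⟨hε.1.le, hε.2⟩ hτ)
    · filter_upwards [hev] with ε hε
      filter_upwards [ae_restrict_mem measurableSet_Ioc] with τ hτ
      have h1 : ‖((1 - |τ| : ℝ) : ℂ)‖ ≤ 1 := by
        rw [Complex.norm_real, Real.norm_eq_abs, abs_le]
        have := abs_le.mpr ⟨hτ.1.le, hτ.2⟩
        have := abs_nonneg τ
        constructor <;> linarith
      have h2 : ‖Complex.exp (τ * (L * y) * Complex.I)‖ = 1 := by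
        exact_mod_cast Complex.norm_exp_ofReal_mul_I (τ * (L * y))
      rw [norm_mul, norm_mul, h2, mul_one]
      calc _ ≤ 1 * B := mul_le_mul h1 (hB _ (hmem ⟨hε.1.le, hε.2⟩ hτ)) (norm_nonneg _) one_pos.le
        _ = B := one_mul B
    · filter_upwards [ae_restrict_mem measurableSet_Ioc] with τ hτ
      refine Tendsto.const_mul _ ?_
      have h0 : (L * τ * Complex.I : ℂ) ∈ {w : ℂ | 0 ≤ w.re} := by simp
      refine (hc _ h0).tendsto.comp (tendsto_nhdsWithin_iff.mpr ⟨?_, ?_⟩)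
      · have h : Tendsto (fun ε : ℝ ↦ (ε + L * τ * Complex.I : ℂ)) (𝓝 0)
          (𝓝 ((0 : ℝ) + L * τ * Complex.I : ℂ)) := Continuous.tendsto (by fun_prop) 0
        simpa using h.mono_left nhdsWithin_le_nhds
      · filter_upwards [hev] with ε hε using hKs (hmem ⟨hε.1.le, hε.2⟩ hτ)
  refine tendsto_nhds_unique (hlhs.congr' ?_) hrhs
  filter_upwards [self_mem_nhdsWithin] with ε hε using integral_mul_exp_mul_fejer ha hM hH hε L y

lemma tendsto_integral_mul_fejer {a : ℝ → ℝ} (ha : Measurable a) {M : ℝ} (hM : ∀ u, |a u| ≤ M)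
    {H : ℂ → ℂ} (hc : ContinuousOn H {w | 0 ≤ w.re})
    (hH : ∀ w : ℂ, 0 < w.re → ∫ u in Ioi (0 : ℝ), (a u : ℂ) * Complex.exp (-w * u) = H w)
    {L : ℝ} (hL : 0 < L) :
    Tendsto (fun y ↦ ∫ u in Ioi (0 : ℝ), a u * fejer (L * (y - u))) atTop (𝓝 0) := by
  have hRL := Real.tendsto_integral_exp_smul_cocompact ((Ioc (-1 : ℝ) 1).indicator fun τ ↦
    ((1 - |τ| : ℝ) : ℂ) * H (L * τ * Complex.I))
  have hw : Tendsto (fun y : ℝ ↦ -(L / (2 * Real.pi)) * y) atTop (cocompact ℝ) :=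
    (tendsto_id.const_mul_atTop_of_neg (by have := Real.pi_pos; simp; positivity)).mono_right
      atBot_le_cocompact
  suffices h : Tendsto (fun y ↦ ((∫ u in Ioi (0 : ℝ), a u * fejer (L * (y - u)) : ℝ) : ℂ)) atTop
      (𝓝 0) by
    have h' := (Complex.continuous_re.tendsto 0).comp h
    rwa [Complex.zero_re] at h'
  refine (hRL.comp hw).congr fun y ↦ ?_
  have := integral_mul_fejer ha hM hc hH hL y
  simp only [Function.comp_apply]
  refine Eq.trans ?_ this.symm
  rw [intervalIntegral.integral_of_le (by norm_num), ← integral_indicator measurableSet_Ioc]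
  congr 1 with τ
  by_cases hτ : τ ∈ Ioc (-1 : ℝ) 1
  · simp only [indicator_of_mem hτ, Circle.smul_def, Real.fourierChar_apply, smul_eq_mul]
    have hpi : (Real.pi : ℂ) ≠ 0 := by exact_mod_cast Real.pi_ne_zero
    rw [show ((2 * Real.pi * -(τ * (-(L / (2 * Real.pi)) * y)) : ℝ) : ℂ) * Complex.I
      = τ * (L * y) * Complex.I by push_cast; field_simp]
    ring
  · simp [indicator_of_notMem hτ]

lemma integral_mul_fejer_comp (g : ℝ → ℝ) {L : ℝ} (hL : 0 < L) (y : ℝ) :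
    ∫ v, g (y - v / L) * fejer v = L * ∫ u, g u * fejer (L * (y - u)) := by
  have h1 := Measure.integral_comp_div (fun u ↦ g (y - u) * fejer (L * u)) L
  have h2 := integral_sub_left_eq_self (fun u ↦ g u * fejer (L * (y - u))) volume y
  rw [← h2, ← smul_eq_mul, ← abs_of_pos hL]
  simp only [sub_sub_cancel]
  rw [abs_of_pos hL] at h1 ⊢
  rw [← h1]
  congr 1 with v
  rw [mul_div_cancel₀ _ hL.ne']

lemma integrable_comp_mul_fejer {A : ℝ → ℝ} (hA : Measurable A) {M : ℝ} (hM : ∀ u, |A u| ≤ M)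
    (L y : ℝ) : Integrable fun v ↦ A (y - v / L) * fejer v :=
  integrable_fejer.bdd_mul (hA.comp (by fun_prop)).aestronglyMeasurable (ae_of_all _ fun _ ↦ hM _)

lemma tendsto_integral_comp_mul_fejer {A : ℝ → ℝ} (hA : Measurable A) {M : ℝ}
    (hM : ∀ u, |A u| ≤ M) (hneg : ∀ u ≤ 0, A u = 0) {H : ℂ → ℂ}
    (hc : ContinuousOn H {w | 0 ≤ w.re})
    (hH : ∀ w : ℂ, 0 < w.re →
      ∫ u in Ioi (0 : ℝ), (A u : ℂ) * Complex.exp (-w * u) = 1 / w + H w)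
    {L : ℝ} (hL : 0 < L) :
    Tendsto (fun y ↦ ∫ v, A (y - v / L) * fejer v) atTop (𝓝 (∫ x, fejer x)) := by
  have hJ : Tendsto (fun y ↦ ∫ u in Ioi (0 : ℝ), (A u - 1) * fejer (L * (y - u))) atTop
      (𝓝 0) := by
    refine tendsto_integral_mul_fejer (hA.sub_const 1) (M := M + 1) (fun u ↦ ?_) hc
      (fun w hw ↦ ?_) hL
    · calc |A u - 1| ≤ |A u| + |1| := abs_sub _ _
        _ ≤ M + 1 := by rw [abs_one]; linarith [hM u]
    · have hw' : (-w).re < 0 := by simpa using hw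
      have hE := integrableOn_exp_mul_complex_Ioi hw' 0
      have hAE : IntegrableOn (fun u : ℝ ↦ (A u : ℂ) * Complex.exp (-w * u)) (Ioi 0) :=
        hE.bdd_mul (c := M) (by fun_prop) (ae_of_all _ fun u ↦ by
          rw [Complex.norm_real]; exact hM u)
      have := integral_exp_mul_complex_Ioi hw' 0
      simp only [Complex.ofReal_sub, Complex.ofReal_one, sub_mul, one_mul]
      rw [integral_sub hAE hE, hH w hw, this]
      simp
  have hind : Tendsto (fun y ↦ ∫ v, (Ioi (0 : ℝ)).indicator 1 (y - v / L) * fejer v) atTop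
      (𝓝 (∫ x, fejer x)) := by
    refine tendsto_integral_filter_of_dominated_convergence fejer ?_ ?_ integrable_fejer ?_
    · have := continuous_fejer.measurable
      have h1 : Measurable ((Ioi (0 : ℝ)).indicator (1 : ℝ → ℝ)) :=
        measurable_one.indicator measurableSet_Ioi
      exact Eventually.of_forall fun y ↦ Measurable.aestronglyMeasurable (by fun_prop)
    · refine Eventually.of_forall fun y ↦ ae_of_all _ fun v ↦ ?_
      rw [norm_mul, Real.norm_of_nonneg (fejer_nonneg v)]
      refine mul_le_of_le_one_left (fejer_nonneg v) ?_
      refine (norm_indicator_le_norm_self _ _).trans ?_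
      simp
    · refine ae_of_all _ fun v ↦ tendsto_const_nhds.congr' ?_
      filter_upwards [eventually_gt_atTop (v / L)] with y hy
      rw [indicator_of_mem (by simpa using hy)]
      simp
  have hsum := (hJ.const_mul L).add hind
  rw [mul_zero, zero_add] at hsum
  refine hsum.congr fun y ↦ ?_
  rw [integral_mul_fejer_comp _ hL, integral_mul_fejer_comp _ hL, ← mul_add]
  congr 1
  have e1 : ∫ u, (Ioi (0 : ℝ)).indicator 1 u * fejer (L * (y - u))
      = ∫ u in Ioi (0 : ℝ), fejer (L * (y - u)) := by
    rw [← integral_indicator measurableSet_Ioi]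
    congr 1 with u
    by_cases hu : u ∈ Ioi (0 : ℝ) <;> simp [hu]
  have e2 : ∫ u, A u * fejer (L * (y - u)) = ∫ u in Ioi (0 : ℝ), A u * fejer (L * (y - u)) := by
    rw [← integral_indicator measurableSet_Ioi]
    congr 1 with u
    by_cases hu : u ∈ Ioi (0 : ℝ)
    · simp [hu]
    · rw [indicator_of_notMem hu, hneg u (by simpa using hu), zero_mul]
  have hF : Integrable (fun u ↦ fejer (L * (y - u))) (volume.restrict (Ioi 0)) :=
    (integrable_fejer_comp hL y).integrableOn
  have hAF : Integrable (fun u ↦ A u * fejer (L * (y - u))) (volume.restrict (Ioi 0)) :=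
    hF.bdd_mul hA.aestronglyMeasurable (ae_of_all _ hM)
  rw [e1, e2]
  simp only [sub_mul, one_mul]
  rw [integral_sub hAF hF]
  ring

lemma integral_comp_mul_fejer_ge {A : ℝ → ℝ} (hA : Measurable A) {M : ℝ} (hM : ∀ u, A u ≤ M)
    (h0 : ∀ u, 0 ≤ A u) (hmono : Monotone fun u ↦ A u * Real.exp u) {L R : ℝ} (hL : 0 < L)
    (y : ℝ) :
    Real.exp (-(2 * R / L)) * A y * ∫ v in Icc (-R) R, fejer v ≤
      ∫ v, A (y + R / L - v / L) * fejer v := by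
  have hInt := integrable_comp_mul_fejer hA (fun u ↦ (abs_of_nonneg (h0 u)).trans_le (hM u)) L
    (y + R / L)
  rw [← integral_const_mul]
  calc ∫ v in Icc (-R) R, Real.exp (-(2 * R / L)) * A y * fejer v
      ≤ ∫ v in Icc (-R) R, A (y + R / L - v / L) * fejer v := by
        refine setIntegral_mono_on (integrable_fejer.const_mul _).integrableOn hInt.integrableOn
          measurableSet_Icc fun v hv ↦ ?_
        refine mul_le_mul_of_nonneg_right ?_ (fejer_nonneg v)
        have hy : y ≤ y + R / L - v / L := by
          have := div_le_div_of_nonneg_right hv.2 hL.le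
          linarith
        have hy' : y + R / L - v / L ≤ y + 2 * R / L := by
          have := div_le_div_of_nonneg_right hv.1 hL.le
          have e : 2 * R / L = R / L - -R / L := by ring
          linarith
        have h1 := hmono hy
        simp only at h1
        have h2 : A (y + R / L - v / L) * Real.exp (y + R / L - v / L)
            ≤ A (y + R / L - v / L) * Real.exp (y + 2 * R / L) := by
          have := h0 (y + R / L - v / L)
          gcongr
        have h3 := h1.trans h2
        rw [Real.exp_add, mul_comm (Real.exp y), ← mul_assoc] at h3
        have h4 := le_of_mul_le_mul_right h3 (Real.exp_pos y)
        rw [Real.exp_neg, inv_mul_le_iff₀ (Real.exp_pos _)]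
        linarith
    _ ≤ _ := setIntegral_le_integral hInt (ae_of_all _ fun v ↦ mul_nonneg (h0 _) (fejer_nonneg v))

lemma integral_comp_mul_fejer_le {A : ℝ → ℝ} (hA : Measurable A) {M : ℝ} (hM : ∀ u, A u ≤ M)
    (h0 : ∀ u, 0 ≤ A u) (hmono : Monotone fun u ↦ A u * Real.exp u) {L R : ℝ} (hL : 0 < L)
    (y : ℝ) :
    ∫ v, A (y - R / L - v / L) * fejer v ≤ Real.exp (2 * R / L) * A y *
      (∫ v in Icc (-R) R, fejer v) + M * ((∫ v, fejer v) - ∫ v in Icc (-R) R, fejer v) := by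
  have hInt := integrable_comp_mul_fejer hA (fun u ↦ (abs_of_nonneg (h0 u)).trans_le (hM u)) L
    (y - R / L)
  rw [← integral_add_compl (measurableSet_Icc (a := -R) (b := R)) hInt,
    ← integral_add_compl (measurableSet_Icc (a := -R) (b := R)) integrable_fejer,
    add_sub_cancel_left, ← integral_const_mul, ← integral_const_mul]
  refine add_le_add ?_ ?_
  · refine setIntegral_mono_on hInt.integrableOn (integrable_fejer.const_mul _).integrableOn
      measurableSet_Icc fun v hv ↦ ?_
    refine mul_le_mul_of_nonneg_right ?_ (fejer_nonneg v)
    have hy : y - R / L - v / L ≤ y := by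
      have := div_le_div_of_nonneg_right hv.1 hL.le
      rw [neg_div] at this
      linarith
    have hy' : y ≤ y - R / L - v / L + 2 * R / L := by
      have := div_le_div_of_nonneg_right hv.2 hL.le
      have e : 2 * R / L = R / L + R / L := by ring
      linarith
    have h1 := hmono hy
    simp only at h1
    have h2 : A y * Real.exp y ≤ A y * Real.exp (y - R / L - v / L + 2 * R / L) := by
      have := h0 y
      gcongr
    have h3 := h1.trans h2
    rw [Real.exp_add, mul_comm (Real.exp _) (Real.exp (2 * R / L)), ← mul_assoc] at h3
    linarith [le_of_mul_le_mul_right h3 (Real.exp_pos _)]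
  · refine setIntegral_mono_on hInt.integrableOn (integrable_fejer.const_mul _).integrableOn
      measurableSet_Icc.compl fun v _ ↦ ?_
    exact mul_le_mul_of_nonneg_right (hM _) (fejer_nonneg v)

/-- A Tauberian theorem of Wiener–Ikehara type, for bounded functions. -/
theorem tendsto_one_of_laplace_continuousOn {A : ℝ → ℝ} (hA : Measurable A) {M : ℝ}
    (hM : ∀ u, A u ≤ M) (h0 : ∀ u, 0 ≤ A u) (hmono : Monotone fun u ↦ A u * Real.exp u)
    (hneg : ∀ u ≤ 0, A u = 0) {H : ℂ → ℂ} (hc : ContinuousOn H {w | 0 ≤ w.re})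
    (hH : ∀ w : ℂ, 0 < w.re →
      ∫ u in Ioi (0 : ℝ), (A u : ℂ) * Complex.exp (-w * u) = 1 / w + H w) :
    Tendsto A atTop (𝓝 1) := by
  set c := ∫ v, fejer v with hcdef
  have hcpos : 0 < c := integral_fejer_pos
  set κ : ℝ → ℝ := fun L ↦ ∫ v in Icc (-√L) √L, fejer v with hκ
  have hT {L : ℝ} (hL : 0 < L) := tendsto_integral_comp_mul_fejer hA
    (fun u ↦ (abs_of_nonneg (h0 u)).trans_le (hM u)) hneg hc hH hL
  have hκlim : Tendsto κ atTop (𝓝 c) := by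
    have hcov : AECover (volume : Measure ℝ) atTop fun L : ℝ ↦ Icc (-√L) √L :=
      aecover_Icc (tendsto_neg_atBot_iff.mpr Real.tendsto_sqrt_atTop) Real.tendsto_sqrt_atTop
    exact hcov.integral_tendsto_of_countably_generated integrable_fejer
  have hexp : Tendsto (fun L : ℝ ↦ 2 * √L / L) atTop (𝓝 0) := by
    have h1 : Tendsto (fun L : ℝ ↦ 2 * (√L)⁻¹) atTop (𝓝 (2 * 0)) :=
      (Real.tendsto_sqrt_atTop.inv_tendsto_atTop).const_mul 2
    rw [mul_zero] at h1
    refine h1.congr' ?_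
    filter_upwards [eventually_gt_atTop 0] with L hL
    rw [mul_div_assoc, Real.sqrt_div_self]
  rw [tendsto_order]
  constructor
  · intro b hb
    have hlim : Tendsto (fun L : ℝ ↦ Real.exp (-(2 * √L / L)) * ((c - M * (c - κ L)) / κ L))
        atTop (𝓝 1) := by
      have h1 := (Real.continuous_exp.tendsto _).comp hexp.neg
      have h2 := (tendsto_const_nhds (x := c)).sub
        (((tendsto_const_nhds (x := c)).sub hκlim).const_mul M)
      have h3 := h1.mul (h2.div hκlim hcpos.ne')
      simpa [hcpos.ne'] using h3
    obtain ⟨L, hL1, hLκ, hL⟩ := ((hlim.eventually (lt_mem_nhds hb)).and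
      ((hκlim.eventually (lt_mem_nhds hcpos)).and (eventually_gt_atTop 0))).exists
    have hlim2 := ((((hT hL).comp (tendsto_atTop_add_const_right atTop (-(√L / L))
      tendsto_id)).sub_const (M * (c - κ L))).div_const (κ L)).const_mul
        (Real.exp (-(2 * √L / L)))
    filter_upwards [hlim2.eventually (lt_mem_nhds hL1)] with y hy
    refine hy.trans_le ?_
    have := integral_comp_mul_fejer_le hA hM h0 hmono (R := √L) hL y
    simp only [Function.comp_apply, id_eq, ← sub_eq_add_neg]
    rw [Real.exp_neg, inv_mul_le_iff₀ (Real.exp_pos _), div_le_iff₀ hLκ]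
    linarith
  · intro b hb
    have hlim : Tendsto (fun L : ℝ ↦ Real.exp (2 * √L / L) * (c / κ L)) atTop (𝓝 1) := by
      have h1 := (Real.continuous_exp.tendsto _).comp hexp
      have h3 := h1.mul ((tendsto_const_nhds (x := c)).div hκlim hcpos.ne')
      simpa [hcpos.ne'] using h3
    obtain ⟨L, hL1, hLκ, hL⟩ := ((hlim.eventually (gt_mem_nhds hb)).and
      ((hκlim.eventually (lt_mem_nhds hcpos)).and (eventually_gt_atTop 0))).exists
    have hlim2 := (((hT hL).comp (tendsto_atTop_add_const_right atTop (√L / L)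
      tendsto_id)).div_const (κ L)).const_mul (Real.exp (2 * √L / L))
    filter_upwards [hlim2.eventually (gt_mem_nhds hL1)] with y hy
    refine lt_of_le_of_lt ?_ hy
    have := integral_comp_mul_fejer_ge hA hM h0 hmono (R := √L) hL y
    simp only [Function.comp_apply, id_eq]
    rw [Real.exp_neg, mul_assoc, inv_mul_le_iff₀ (Real.exp_pos _)] at this
    rw [← mul_div_assoc, le_div_iff₀ hLκ]
    linarith

open Chebyshev ArithmeticFunction in
lemma LSeries_vonMangoldt_eq_mul_integral_psi {s : ℂ} (hs : 1 < s.re) :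
    LSeries (fun n ↦ (vonMangoldt n : ℂ)) s =
      s * ∫ t in Ioi (1 : ℝ), (psi t : ℂ) * (t : ℂ) ^ (-(s + 1)) := by
  have hsum (x : ℝ) : ∑ k ∈ Finset.Icc 1 ⌊x⌋₊, vonMangoldt k = psi x := by
    rw [psi, ← Finset.Icc_add_one_left_eq_Ioc, zero_add]
  have hO : (fun n : ℕ ↦ ∑ k ∈ Finset.Icc 1 n, vonMangoldt k) =O[atTop]
      fun n ↦ (n : ℝ) ^ (1 : ℝ) := by
    refine Asymptotics.IsBigO.of_bound (Real.log 4 + 4) (Eventually.of_forall fun n ↦ ?_)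
    have := hsum n
    rw [Nat.floor_natCast] at this
    rw [this, Real.rpow_one, Real.norm_of_nonneg (psi_nonneg _),
      Real.norm_of_nonneg n.cast_nonneg]
    exact psi_le_const_mul_self n.cast_nonneg
  rw [LSeries_eq_mul_integral_of_nonneg _ zero_le_one hs hO fun _ ↦ vonMangoldt_nonneg]
  congr 2 with t
  rw [← hsum t]
  push_cast
  rfl

open ArithmeticFunction in
/-- The negative logarithmic derivative of `ζ` without its pole at `1` extends continuously to
`1 ≤ re s`. -/
lemma exists_continuousOn_LSeries_vonMangoldt_sub :
    ∃ G : ℂ → ℂ, ContinuousOn G {s | 1 ≤ s.re} ∧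
      ∀ s : ℂ, 1 < s.re → LSeries (fun n ↦ (vonMangoldt n : ℂ)) s = G s + 1 / (s - 1) := by
  refine ⟨vonMangoldt.LFunctionResidueClassAux (1 : ZMod 1),
    vonMangoldt.continuousOn_LFunctionResidueClassAux 1, fun s hs ↦ ?_⟩
  rw [vonMangoldt.eqOn_LFunctionResidueClassAux isUnit_one hs]
  have : (vonMangoldt.residueClass (1 : ZMod 1)) = vonMangoldt := by
    ext n
    rw [vonMangoldt.residueClass]
    exact indicator_of_mem (s := {n : ℕ | (n : ZMod 1) = 1})
      (mem_ofPred.mpr (Subsingleton.elim _ _)) _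
  simp [this]

open Chebyshev in
lemma tendsto_exp_neg_mul_psi_exp :
    Tendsto (fun u ↦ Real.exp (-u) * psi (Real.exp u)) atTop (𝓝 1) := by
  obtain ⟨G, hG, hGs⟩ := exists_continuousOn_LSeries_vonMangoldt_sub
  have hre {w : ℂ} (hw : 0 ≤ w.re) : 1 + w ≠ 0 := fun h ↦ by
    have := congrArg Complex.re h
    simp at this
    linarith
  refine tendsto_one_of_laplace_continuousOn (M := Real.log 4 + 4)
    (H := fun w ↦ (G (1 + w) - 1) / (1 + w)) ?_ (fun u ↦ ?_) (fun u ↦ ?_) ?_ (fun u hu ↦ ?_) ?_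
    fun w hw ↦ ?_
  · have := psi_mono.measurable
    fun_prop
  · rw [Real.exp_neg, inv_mul_le_iff₀ (Real.exp_pos u), mul_comm]
    exact psi_le_const_mul_self (Real.exp_nonneg u)
  · exact mul_nonneg (Real.exp_nonneg _) (psi_nonneg _)
  · have : (fun u ↦ Real.exp (-u) * psi (Real.exp u) * Real.exp u)
        = fun u ↦ psi (Real.exp u) := by
      ext u
      rw [mul_right_comm, ← Real.exp_add, neg_add_cancel, Real.exp_zero, one_mul]
    rw [this]
    exact psi_mono.comp Real.exp_monotone
  · rw [psi_eq_zero_of_le_one (Real.exp_le_one_iff.mpr hu), mul_zero]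
  · refine ContinuousOn.div ((hG.comp (by fun_prop) fun w hw ↦ ?_).sub continuousOn_const)
      (by fun_prop) fun w hw ↦ hre hw
    simpa using hw
  · have hs : 1 < (1 + w).re := by simpa using hw
    have h1 := LSeries_vonMangoldt_eq_mul_integral_psi hs
    have h2 := integral_comp_exp_Ioi
      (fun t : ℝ ↦ (psi t : ℂ) * (t : ℂ) ^ (-((1 + w) + 1))) 0
    rw [Real.exp_zero] at h2
    have h3 : ∫ u in Ioi (0 : ℝ), ((Real.exp (-u) * psi (Real.exp u) : ℝ) : ℂ) *
        Complex.exp (-w * u)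
        = ∫ t in Ioi (1 : ℝ), (psi t : ℂ) * (t : ℂ) ^ (-((1 + w) + 1)) := by
      rw [← h2]
      congr 1 with u
      have hE : (Real.exp u : ℂ) ≠ 0 := by exact_mod_cast (Real.exp_pos u).ne'
      rw [Complex.cpow_def_of_ne_zero hE, ← Complex.ofReal_log (Real.exp_nonneg u), Real.log_exp,
        Complex.real_smul]
      push_cast
      rw [show (u : ℂ) * -(1 + w + 1) = -u + -w * u + -u by ring, Complex.exp_add,
        Complex.exp_add]
      have hE2 : Complex.exp u * Complex.exp (-u) = 1 := by
        rw [← Complex.exp_add, add_neg_cancel, Complex.exp_zero]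
      linear_combination (-(Complex.exp (-u) * psi (Real.exp u) * Complex.exp (-w * u))) * hE2
    rw [h3]
    rw [hGs _ hs, add_sub_cancel_left] at h1
    have hw0 : w ≠ 0 := fun h ↦ by simp [h] at hw
    have hw1 := hre hw.le
    have h4 := eq_div_of_mul_eq hw1 ((mul_comm _ _).trans h1.symm)
    rw [h4]
    field_simp
    ring

open Chebyshev Real

/-- The **prime number theorem** for the Chebyshev function `ψ`. -/
theorem tendsto_psi_div_id : Tendsto (fun x ↦ psi x / x) atTop (𝓝 1) := by
  refine (tendsto_exp_neg_mul_psi_exp.comp tendsto_log_atTop).congr' ?_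
  filter_upwards [eventually_gt_atTop 0] with x hx
  rw [Function.comp_apply, exp_neg, exp_log hx]
  ring

theorem tendsto_theta_div_id : Tendsto (fun x ↦ theta x / x) atTop (𝓝 1) := by
  have h : Tendsto (fun x ↦ (psi x - theta x) / x) atTop (𝓝 0) := by
    refine (isBigO_psi_sub_theta_sqrt.trans_isLittleO ?_).tendsto_div_nhds_zero
    refine Asymptotics.isLittleO_of_tendsto' ?_ ?_
    · filter_upwards [eventually_gt_atTop 0] with x hx h using absurd h hx.ne'
    · simp_rw [sqrt_div_self]
      exact tendsto_sqrt_atTop.inv_tendsto_atTop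
  have := tendsto_psi_div_id.sub h
  rw [sub_zero] at this
  exact this.congr fun x ↦ by ring

/-- The **prime number theorem**. -/
theorem tendsto_primeCounting_mul_log_div_id :
    Tendsto (fun x : ℝ ↦ Nat.primeCounting ⌊x⌋₊ * log x / x) atTop (𝓝 1) := by
  have h1 := integral_theta_div_log_sq_isLittleO.tendsto_div_nhds_zero
  have h2 := tendsto_theta_div_id.add h1
  rw [add_zero] at h2
  refine h2.congr' ?_
  filter_upwards [eventually_ge_atTop 2] with x hx
  have : 0 < log x := log_pos (by linarith)
  rw [primeCounting_eq_theta_div_log_add_integral hx]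
  field_simp

/-- The number of odd primes up to `x`. -/
noncomputable def oddPrimeCount (x : ℝ) : ℕ :=
  ((Finset.range (⌊x⌋₊ + 1)).filter fun p ↦ p.Prime ∧ Odd p).card

lemma oddPrimeCount_le_primeCounting (x : ℝ) : oddPrimeCount x ≤ Nat.primeCounting ⌊x⌋₊ := by
  rw [oddPrimeCount, Nat.primeCounting, Nat.primeCounting', Nat.count_eq_card_filter_range]
  exact Finset.card_le_card (Finset.monotone_filter_right _ fun _ _ h ↦ h.1)

lemma primeCounting_le_oddPrimeCount_add_one (x : ℝ) :
    Nat.primeCounting ⌊x⌋₊ ≤ oddPrimeCount x + 1 := by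
  rw [oddPrimeCount, Nat.primeCounting, Nat.primeCounting', Nat.count_eq_card_filter_range]
  refine (Finset.card_le_card (t := insert 2 _) fun p hp ↦ ?_).trans (Finset.card_insert_le 2 _)
  rw [Finset.mem_filter] at hp
  rcases hp.2.eq_two_or_odd' with h | h
  · simp [h]
  · exact Finset.mem_insert_of_mem (Finset.mem_filter.mpr ⟨hp.1, hp.2, h⟩)

lemma oddPrimeCount_le_floor (x : ℝ) : oddPrimeCount x ≤ ⌊x⌋₊ := by
  refine (oddPrimeCount_le_primeCounting x).trans ?_
  rw [← Nat.primesLE_card_eq_primeCounting]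
  refine (Finset.card_le_card (t := Finset.Icc 1 ⌊x⌋₊) fun p hp ↦ ?_).trans_eq (by simp)
  rw [Nat.mem_primesLE] at hp
  exact Finset.mem_Icc.mpr ⟨hp.2.one_le, hp.1⟩

lemma monotone_oddPrimeCount : Monotone oddPrimeCount := fun x y h ↦ by
  have := Nat.floor_le_floor h
  exact Finset.card_le_card (Finset.filter_subset_filter _ (Finset.range_mono (by lia)))

lemma measurable_oddPrimeCount : Measurable fun x ↦ (oddPrimeCount x : ℝ) :=
  (Nat.mono_cast.comp monotone_oddPrimeCount).measurable

lemma tendsto_oddPrimeCount_mul_log_div_id :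
    Tendsto (fun x : ℝ ↦ oddPrimeCount x * log x / x) atTop (𝓝 1) := by
  have h1 := tendsto_primeCounting_mul_log_div_id
  have h2 : Tendsto (fun x ↦ log x / x) atTop (𝓝 0) :=
    isLittleO_log_id_atTop.tendsto_div_nhds_zero
  have h3 := h1.sub h2
  rw [sub_zero] at h3
  refine tendsto_of_tendsto_of_tendsto_of_le_of_le' h3 h1 ?_ ?_
  · filter_upwards [eventually_ge_atTop 1] with x hx
    have hl := log_nonneg hx
    rw [← sub_div, ← sub_one_mul]
    gcongr
    rw [sub_le_iff_le_add]
    exact_mod_cast primeCounting_le_oddPrimeCount_add_one x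
  · filter_upwards [eventually_ge_atTop 1] with x hx
    have hl := log_nonneg hx
    gcongr
    exact oddPrimeCount_le_primeCounting x

lemma oddPrimeCount_mul_log_le {x : ℝ} (hx : 1 < x) :
    oddPrimeCount x * log x ≤ (2 * log 4 + 2) * x := by
  have h1 : (oddPrimeCount x : ℝ) ≤ log 4 * x / log √x + √x :=
    le_trans (by exact_mod_cast oddPrimeCount_le_primeCounting x) (pi_le_log4_mul_div hx)
  have hs : 1 < √x := by rw [lt_sqrt zero_le_one]; simpa using hx
  have hl : 0 < log √x := log_pos hs
  have hl2 : log √x ≤ √x := (log_le_sub_one_of_pos (by linarith)).trans (by linarith)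
  have e : log x = 2 * log √x := by rw [log_sqrt (by linarith)]; ring
  have hsq : √x * √x = x := mul_self_sqrt (by linarith)
  rw [e]
  calc oddPrimeCount x * (2 * log √x) ≤ (log 4 * x / log √x + √x) * (2 * log √x) := by gcongr
    _ = 2 * log 4 * x + 2 * (√x * log √x) := by field_simp
    _ ≤ 2 * log 4 * x + 2 * (√x * √x) := by gcongr
    _ = (2 * log 4 + 2) * x := by rw [hsq]; ring

lemma f_exp_neg_eq_integral {t : ℝ} (ht : 0 < t) :
    f (exp (-t)) = ∫ y in Ioi (0 : ℝ), oddPrimeCount (y / t) * exp (-y) := by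
  set F : ℕ → ℝ → ℝ := fun p ↦ if p.Prime ∧ Odd p then
    (Ici (p * t)).indicator (fun y ↦ exp (-y)) else 0 with hF
  have hexp (c : ℝ) : IntegrableOn (fun y ↦ exp (-y)) (Ioi c) := by
    simpa using integrableOn_exp_mul_Ioi (a := -1) (by norm_num) c
  have hInt (p : ℕ) : Integrable (F p) (volume.restrict (Ioi 0)) := by
    by_cases hp : p.Prime ∧ Odd p
    · simp only [hF, if_pos hp]
      exact (hexp 0).indicator measurableSet_Ici
    · simp only [hF, if_neg hp]
      exact integrable_zero _ _ _
  have hval (p : ℕ) : ∫ y in Ioi (0 : ℝ), F p y = if p.Prime ∧ Odd p then exp (-t) ^ p else 0 := by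
    by_cases hp : p.Prime ∧ Odd p
    · have hpt : 0 < p * t := mul_pos (by exact_mod_cast hp.1.pos) ht
      simp only [hF, if_pos hp]
      rw [setIntegral_indicator measurableSet_Ici,
        inter_eq_self_of_subset_right (Ici_subset_Ioi.mpr hpt), integral_Ici_eq_integral_Ioi,
        integral_exp_neg_Ioi, ← exp_nat_mul, mul_neg]
    · simp [hF, hp]
  have hnonneg (p : ℕ) (y : ℝ) : 0 ≤ F p y := by
    by_cases hp : p.Prime ∧ Odd p
    · simp only [hF, if_pos hp]
      exact indicator_nonneg (fun y _ ↦ exp_nonneg _) y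
    · simp [hF, hp]
  have hsum : Summable fun p ↦ ∫ y in Ioi (0 : ℝ), ‖F p y‖ := by
    simp_rw [norm_of_nonneg (hnonneg _ _), hval]
    refine (summable_geometric_of_lt_one (exp_nonneg (-t)) (by simpa using ht)).of_nonneg_of_le
      (fun p ↦ ?_) fun p ↦ ?_
    · split_ifs <;> positivity
    · split_ifs
      · exact le_rfl
      · positivity
  have h := (hasSum_integral_of_summable_integral_norm hInt hsum).tsum_eq
  simp_rw [hval] at h
  rw [f, h]
  refine setIntegral_congr_fun measurableSet_Ioi fun y hy ↦ ?_
  have hiff (p : ℕ) : p ∈ Finset.range (⌊y / t⌋₊ + 1) ↔ p * t ≤ y := by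
    rw [Finset.mem_range, Nat.lt_succ_iff, Nat.le_floor_iff (div_nonneg (mem_Ioi.mp hy).le ht.le),
      le_div_iff₀ ht]
  rw [tsum_eq_sum (s := Finset.range (⌊y / t⌋₊ + 1)), oddPrimeCount, Finset.card_filter,
    Nat.cast_sum, Finset.sum_mul]
  · refine Finset.sum_congr rfl fun p hp ↦ ?_
    by_cases hpp : p.Prime ∧ Odd p
    · simp [hF, hpp, (hiff p).mp hp]
    · simp [hF, hpp]
  · intro p hp
    rw [hiff] at hp
    by_cases hpp : p.Prime ∧ Odd p
    · simp [hF, hpp, hp]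
    · simp [hF, hpp]

lemma mul_log_mul_oddPrimeCount_le {t y : ℝ} (ht : 0 < t) (hy : 0 < y) :
    t * log (1 / t) * oddPrimeCount (y / t) ≤ (2 * log 4 + 2) * y + y ^ 2 + 1 := by
  have h4 : 0 < log 4 := log_pos (by norm_num)
  rcases le_or_gt (y / t) 1 with h | h
  · have hle : oddPrimeCount (y / t) = 0 := by
      rw [oddPrimeCount, Finset.card_eq_zero, Finset.filter_eq_empty_iff]
      intro p hp hpp
      have h1 : ⌊y / t⌋₊ ≤ 1 := Nat.floor_le_one_of_le_one h
      have := hpp.1.two_le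
      rw [Finset.mem_range] at hp
      omega
    rw [hle, Nat.cast_zero, mul_zero]
    positivity
  · have e : log (1 / t) = log (y / t) - log y := by
      rw [← log_div (by positivity) (by positivity)]
      congr 1
      field_simp
    have h1 := oddPrimeCount_mul_log_le h
    have h2 : (oddPrimeCount (y / t) : ℝ) ≤ y / t :=
      le_trans (by exact_mod_cast oddPrimeCount_le_floor _) (Nat.floor_le (by positivity))
    have h3 : -log y * y ≤ 1 := by
      have := one_sub_inv_le_log_of_pos hy
      calc -log y * y ≤ (y⁻¹ - 1) * y := by gcongr; linarith
        _ = 1 - y := by field_simp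
        _ ≤ 1 := by linarith
    have h5 : oddPrimeCount (y / t) * -log y ≤ (1 + y ^ 2) / t := by
      rcases le_or_gt 0 (-log y) with hl | hl
      · calc oddPrimeCount (y / t) * -log y ≤ y / t * -log y := by gcongr
          _ = (-log y * y) / t := by ring
          _ ≤ (1 + y ^ 2) / t := by gcongr; nlinarith [sq_nonneg y]
      · exact (mul_nonpos_of_nonneg_of_nonpos (Nat.cast_nonneg _) hl.le).trans (by positivity)
    calc t * log (1 / t) * oddPrimeCount (y / t)
        = t * (oddPrimeCount (y / t) * log (y / t) + oddPrimeCount (y / t) * -log y) := by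
          rw [e]; ring
      _ ≤ t * ((2 * log 4 + 2) * (y / t) + (1 + y ^ 2) / t) := by gcongr
      _ = _ := by field_simp; ring

lemma tendsto_mul_log_mul_oddPrimeCount {y : ℝ} (hy : 0 < y) :
    Tendsto (fun t ↦ t * log (1 / t) * oddPrimeCount (y / t)) (𝓝[>] 0) (𝓝 y) := by
  have hx : Tendsto (fun t : ℝ ↦ y / t) (𝓝[>] 0) atTop :=
    (tendsto_inv_nhdsGT_zero.const_mul_atTop hy).congr fun t ↦ (div_eq_mul_inv y t).symm
  have h1 := tendsto_oddPrimeCount_mul_log_div_id.comp hx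
  have h2 : Tendsto (fun t : ℝ ↦ 1 - log y / log (y / t)) (𝓝[>] 0) (𝓝 1) := by
    simpa using ((tendsto_log_atTop.comp hx).const_div_atTop (log y)).const_sub 1
  have h3 := (h1.mul h2).const_mul y
  rw [mul_one, mul_one] at h3
  refine h3.congr' ?_
  filter_upwards [self_mem_nhdsWithin, hx.eventually (eventually_gt_atTop 1)] with t ht h
  have ht' : 0 < t := ht
  have hl : 0 < log (y / t) := log_pos h
  have e : log (1 / t) = log (y / t) - log y := by
    rw [← log_div (by positivity) (by positivity)]
    congr 1
    field_simp
  rw [Function.comp_apply, e]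
  field_simp

lemma integrableOn_pow_mul_exp_neg (n : ℕ) :
    IntegrableOn (fun y : ℝ ↦ y ^ n * exp (-y)) (Ioi 0) := by
  refine (GammaIntegral_convergent (s := n + 1) (by positivity)).congr_fun (fun y _ ↦ ?_)
    measurableSet_Ioi
  simp [mul_comm]

lemma tendsto_mul_log_mul_f_exp_neg :
    Tendsto (fun t ↦ t * log (1 / t) * f (exp (-t))) (𝓝[>] 0) (𝓝 1) := by
  have h1 : ∫ y in Ioi (0 : ℝ), y * exp (-y) = 1 := by
    have := Gamma_eq_integral (s := 2) (by norm_num)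
    rw [Gamma_two] at this
    rw [this]
    refine setIntegral_congr_fun measurableSet_Ioi fun y _ ↦ ?_
    norm_num [mul_comm]
  have hlim : Tendsto (fun t ↦ ∫ y in Ioi (0 : ℝ),
      t * log (1 / t) * oddPrimeCount (y / t) * exp (-y)) (𝓝[>] 0)
      (𝓝 (∫ y in Ioi (0 : ℝ), y * exp (-y))) := by
    refine tendsto_integral_filter_of_dominated_convergence
      (fun y ↦ ((2 * log 4 + 2) * y + y ^ 2 + 1) * exp (-y)) ?_ ?_ ?_ ?_
    · refine Eventually.of_forall fun t ↦ Measurable.aestronglyMeasurable ?_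
      have h : Measurable fun y : ℝ ↦ (oddPrimeCount (y / t) : ℝ) :=
        measurable_oddPrimeCount.comp (measurable_id.div_const t)
      exact (h.const_mul _).mul (by fun_prop)
    · filter_upwards [Ioc_mem_nhdsGT one_pos] with t ht
      filter_upwards [ae_restrict_mem measurableSet_Ioi] with y hy
      have hl : 0 ≤ log (1 / t) := log_nonneg (by rw [le_div_iff₀ ht.1]; linarith [ht.2])
      have ht0 := ht.1
      rw [norm_of_nonneg (by positivity)]
      gcongr
      exact mul_log_mul_oddPrimeCount_le ht.1 hy
    · have := (((integrableOn_pow_mul_exp_neg 1).const_mul (2 * log 4 + 2)).add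
        (integrableOn_pow_mul_exp_neg 2)).add (integrableOn_pow_mul_exp_neg 0)
      refine this.congr (ae_of_all _ fun y ↦ ?_)
      simp only [Pi.add_apply]
      ring
    · filter_upwards [ae_restrict_mem measurableSet_Ioi] with y hy
      exact (tendsto_mul_log_mul_oddPrimeCount hy).mul_const _
  rw [h1] at hlim
  refine hlim.congr' ?_
  filter_upwards [self_mem_nhdsWithin] with t ht
  rw [f_exp_neg_eq_integral ht, ← integral_const_mul]
  simp_rw [mul_assoc]

theorem f_asymptotic_near_one :
    Tendsto (fun z : ℝ => (1 - z) * Real.log (1 / (1 - z)) * f z) (𝓝[<] 1) (𝓝 1) := by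
  have hz : ∀ᶠ z : ℝ in 𝓝[<] 1, z ∈ Ioo (0 : ℝ) 1 := Ioo_mem_nhdsLT one_pos
  have ht : Tendsto (fun z ↦ -log z) (𝓝[<] 1) (𝓝[>] 0) := by
    refine tendsto_nhdsWithin_iff.mpr ⟨?_, ?_⟩
    · have := (continuousAt_log one_ne_zero).tendsto.neg
      rw [log_one, neg_zero] at this
      exact this.mono_left nhdsWithin_le_nhds
    · filter_upwards [hz] with z hz using neg_pos.mpr (log_neg hz.1 hz.2)
  have hr : Tendsto (fun z ↦ (1 - z) / -log z) (𝓝[<] 1) (𝓝 1) := by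
    have h := (hasDerivAt_iff_tendsto_slope.mp (hasDerivAt_log one_ne_zero)).mono_left
      (nhdsWithin_mono 1 fun z (hz : z < 1) ↦ hz.ne)
    have h' := h.inv₀ (by norm_num)
    rw [inv_one, inv_one] at h'
    refine h'.congr fun z ↦ ?_
    rw [slope_def_field, log_one, sub_zero, inv_div, div_neg, ← neg_div, neg_sub]
  have hlogt : Tendsto (fun z ↦ log (-log z)) (𝓝[<] 1) atBot := tendsto_log_nhdsGT_zero.comp ht
  have hq : Tendsto (fun z ↦ log ((1 - z) / -log z) / log (-log z) + 1) (𝓝[<] 1) (𝓝 1) := by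
    have h := ((continuousAt_log one_ne_zero).tendsto.comp hr).div_atBot hlogt
    simpa using h.add_const 1
  have h := (hr.mul hq).mul (tendsto_mul_log_mul_f_exp_neg.comp ht)
  rw [mul_one, mul_one] at h
  refine h.congr' ?_
  filter_upwards [hz, hlogt.eventually (eventually_lt_atBot 0)] with z hz hll
  have hl : 0 < -log z := neg_pos.mpr (log_neg hz.1 hz.2)
  have h1z : 0 < 1 - z := sub_pos.mpr hz.2
  rw [Function.comp_apply, neg_neg, exp_log hz.1, log_div h1z.ne' hl.ne', one_div, one_div,
    log_inv, log_inv]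
  generalize log (-log z) = b at *
  have hb : b ≠ 0 := hll.ne
  generalize -log z = a at *
  field_simp
  ring
end
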